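/- Fix an integer n ≥ 5. As N → ∞, with W = M/(2√(N−2)) for M a UME matrix of dimension N, the expected trace of the Chebyshev polynomial of degree 2n satisfies ⟨Tr[T_{2n}(W)]⟩ = (n/(12N)) [(n+1)(n−1) − 18] + O(N^{−2}). -/

import Mathlib

open MeasureTheory Matrix

noncomputable section

/-- The uniform probability measure on `[0, 2π)`. -/
def uniformPhase : Measure ℝ :=
  (ENNReal.ofReal (2 * Real.pi))⁻¹ • volume.restrict (Set.Ico 0 (2 * Real.pi))

/-- Product measure: the phases `ω μ ν` (used for `μ < ν`) are i.i.d. uniform on `[0, 2π)`. -/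
def phaseMeasure (N : ℕ) : Measure (Fin N → Fin N → ℝ) :=
  Measure.pi fun _ => Measure.pi fun _ => uniformPhase

/-- Antisymmetrized phases built from a raw sample: `φ ν μ = - φ μ ν`, `φ μ μ = 0`. -/
def phases (N : ℕ) (ω : Fin N → Fin N → ℝ) : Fin N → Fin N → ℝ :=
  fun μ ν => if μ < ν then ω μ ν else if ν < μ then - (ω ν μ) else 0

/-- The uni-modular matrix with phases `φ`: zero diagonal, `M μ ν = exp(i φ μ ν)` off diagonal. -/
def umeMatrix (N : ℕ) (φ : Fin N → Fin N → ℝ) : Matrix (Fin N) (Fin N) ℂ :=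
  fun μ ν => if μ = ν then 0 else Complex.exp (Complex.I * (φ μ ν : ℂ))


/-- The scaled UME matrix `W = M / (2√(N−2))`. -/
def scaledUme (N : ℕ) (φ : Fin N → Fin N → ℝ) : Matrix (Fin N) (Fin N) ℂ :=
  ((1 / (2 * Real.sqrt ((N : ℝ) - 2)) : ℝ) : ℂ) • umeMatrix N φ

/-- `Tr[T_n(W)]`, the trace of the `n`-th Chebyshev polynomial of the first kind evaluated
at the scaled UME matrix `W = M/(2√(N−2))`. -/
def chebTrace (N : ℕ) (φ : Fin N → Fin N → ℝ) (n : ℕ) : ℂ :=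
  Matrix.trace (Polynomial.aeval (scaledUme N φ) (Polynomial.Chebyshev.T ℂ n))



/-- Valid closed walks: cyclically non-backtracking and balanced. -/
def UValid {m : ℕ} {V : Type*} (x : ZMod m → V) : Prop :=
  (∀ i, x i ≠ x (i + 1)) ∧ (∀ i, x i ≠ x (i + 2)) ∧
    ∃ τ : Equiv.Perm (ZMod m), ∀ i, x (τ i) = x i ∧ x (τ i - 1) = x (i + 1)

/-- Number of visits of the vertex visited at time `i`. -/
def fib {m : ℕ} [NeZero m] {V : Type*} [DecidableEq V] (x : ZMod m → V) (i : ZMod m) : ℕ :=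
  (Finset.univ.filter (fun j => x j = x i)).card

section comb
variable {m : ℕ} [NeZero m] {V : Type*} [DecidableEq V] {x : ZMod m → V}

lemma fib_congr {i j : ZMod m} (h : x i = x j) : fib x i = fib x j := by
  unfold fib; rw [h]

lemma fib_two_eq {i j k : ZMod m} (hf : fib x i = 2) (hj : x j = x i) (hk : x k = x i)
    (hji : j ≠ i) (hki : k ≠ i) : j = k := by
  by_contra hne
  have : ({i, j, k} : Finset (ZMod m)) ⊆ Finset.univ.filter (fun j => x j = x i) := by
    intro a ha
    simp only [Finset.mem_insert, Finset.mem_singleton] at ha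
    rcases ha with rfl | rfl | rfl <;> simp [*]
  have h3 := Finset.card_le_card this
  rw [Finset.card_eq_three.2 ⟨i, j, k, hji.symm, hki.symm, hne, rfl⟩] at h3
  unfold fib at hf; omega

lemma nb_sub (h : UValid x) (i : ZMod m) : x (i - 1) ≠ x (i + 1) := by
  have := h.2.1 (i - 1)
  rwa [show i - 1 + 2 = i + 1 by ring] at this

lemma step (h : UValid x) {i j : ZMod m} (hf : fib x i = 2) (hij : x i = x j)
    (hb : x (i - 1) = x (j + 1)) : x (i + 1) = x (j - 1) := by
  obtain ⟨τ, hτ⟩ := h.2.2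
  have h1 : τ i ≠ i := by
    intro hc
    have := (hτ i).2
    rw [hc] at this
    exact nb_sub h i this
  have h2 : j ≠ i := by
    rintro rfl
    exact nb_sub h _ hb
  have := fib_two_eq hf (hτ i).1 hij.symm h1 h2
  rw [← this, (hτ i).2]

lemma reflect (h : UValid x) {p q : ZMod m} (h0 : x p = x q) (h1 : x (p + 1) = x (q - 1)) (a : ℕ)
    (hf : ∀ t : ℕ, 0 < t → t < a → fib x (p + t) = 2 ∨ fib x (q - t) = 2) :
    ∀ t : ℕ, t ≤ a → x (p + t) = x (q - t) := by
  have key : ∀ t : ℕ, t + 1 ≤ a →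
      x (p + t) = x (q - t) ∧ x (p + (t + 1 : ℕ)) = x (q - (t + 1 : ℕ)) := by
    intro t
    induction t with
    | zero => intro _; simpa using ⟨h0, h1⟩
    | succ t ih =>
      intro ht
      obtain ⟨e1, e2⟩ := ih (by omega)
      refine ⟨e2, ?_⟩
      have hff : fib x (p + (t + 1 : ℕ)) = 2 := by
        rcases hf (t + 1) (by omega) (by omega) with h | h
        · exact h
        · rw [fib_congr e2]; exact h
      have := step h hff e2 (by
        convert e1 using 2 <;> push_cast <;> ring)
      convert this using 2 <;> push_cast <;> ring
  intro t ht
  rcases Nat.eq_zero_or_pos t with rfl | hpos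
  · simpa using h0
  · obtain ⟨s, rfl⟩ : ∃ s, t = s + 1 := ⟨t - 1, by omega⟩
    exact (key s ht).2

/-- A reflected arc contains two special positions. -/
lemma adj (h : UValid x) {p : ZMod m} {s : ℕ} (hs : 1 ≤ s) (h0 : x p = x (p + s))
    (h1 : x (p + 1) = x (p + s - 1)) :
    ∃ t t' : ℕ, 0 < t ∧ t < t' ∧ t + t' = s ∧ x (p + t) = x (p + t') ∧ fib x (p + t) ≠ 2 := by
  classical
  by_cases hex : ∃ t : ℕ, 0 < t ∧ 2 * t < s ∧ fib x (p + t) ≠ 2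
  · have hsp := Nat.find_spec hex
    set t := Nat.find hex
    have hmin : ∀ r : ℕ, r < t → ¬ (0 < r ∧ 2 * r < s ∧ fib x (p + r) ≠ 2) :=
      fun r hr => Nat.find_min hex hr
    refine ⟨t, s - t, hsp.1, by omega, by omega, ?_, hsp.2.2⟩
    have := reflect h h0 h1 t (fun r hr hr' => by
      left; by_contra hc; exact hmin r hr' ⟨hr, by omega, hc⟩) t le_rfl
    rw [this, Nat.cast_sub (by omega)]; congr 1; ring
  · push Not at hex
    exfalso
    have := reflect h h0 h1 ((s + 1) / 2) (fun r hr hr' => Or.inl (hex r hr (by omega)))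
    rcases Nat.even_or_odd' s with ⟨k, rfl | rfl⟩
    · obtain ⟨k, rfl⟩ : ∃ l, k = l + 1 := ⟨k - 1, by omega⟩
      have e := this k (by omega)
      apply h.2.1 (p + k)
      rw [e]; congr 1; push_cast; ring
    · have e := this k (by omega)
      apply h.1 (p + k)
      rw [e]; congr 1; push_cast; ring

lemma arc (h : UValid x) {p q : ZMod m} (h0 : x p = x q) (h1 : x (p + 1) = x (q - 1)) {a b : ℕ}
    (ha : 0 < a) (hb : 0 < b)
    (hfa : ∀ t : ℕ, 0 < t → t < a → fib x (p + t) = 2) (hfa' : fib x (p + a) ≠ 2)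
    (hfb : ∀ t : ℕ, 0 < t → t < b → fib x (q - t) = 2) (hfb' : fib x (q - b) ≠ 2) :
    a = b ∧ ∀ t : ℕ, t ≤ a → x (p + t) = x (q - t) := by
  have r1 := reflect h h0 h1 a (fun t h1 h2 => Or.inl (hfa t h1 h2))
  have r2 := reflect h h0 h1 b (fun t h1 h2 => Or.inr (hfb t h1 h2))
  refine ⟨?_, r1⟩
  rcases lt_trichotomy a b with hlt | heq | hlt
  · exfalso; apply hfa'; rw [fib_congr (r1 a le_rfl)]; exact hfb a ha hlt
  · exact heq
  · exfalso; apply hfb'; rw [← fib_congr (r2 b le_rfl)]; exact hfa b hb hlt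

end comb



section comb2
variable {m : ℕ} [NeZero m] {V : Type*} [DecidableEq V] {x : ZMod m → V}

lemma cast_inj' {a b : ℕ} (ha : a < m) (hb : b < m) (h : (a : ZMod m) = b) : a = b := by
  rw [ZMod.natCast_eq_natCast_iff'] at h
  rwa [Nat.mod_eq_of_lt ha, Nat.mod_eq_of_lt hb] at h

lemma exists_nat (i : ZMod m) : ∃ t : ℕ, t < m ∧ (t : ZMod m) = i :=
  ⟨i.val, ZMod.val_lt i, ZMod.natCast_zmod_val i⟩

lemma fib_range (i : ZMod m) :
    fib x i = ((Finset.range m).filter (fun t : ℕ => x (t : ZMod m) = x i)).card := by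
  unfold fib
  symm
  apply Finset.card_bij (fun (t : ℕ) _ => (t : ZMod m))
  · intro a ha; simpa using (Finset.mem_filter.1 ha).2
  · intro a ha b hb hab
    exact cast_inj' (by simpa using (Finset.mem_filter.1 ha).1)
      (by simpa using (Finset.mem_filter.1 hb).1) hab
  · intro b hb
    obtain ⟨t, ht, rfl⟩ := exists_nat b
    exact ⟨t, by simpa [ht] using hb, rfl⟩

lemma card_peel {S : Finset ℕ} {k : ℕ} (h : S.card = k + 1) :
    ∃ a T, S = insert a T ∧ (∀ b ∈ T, a < b) ∧ T.card = k := by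
  have hne : S.Nonempty := Finset.card_pos.1 (by omega)
  refine ⟨S.min' hne, S.erase (S.min' hne), ?_, ?_, ?_⟩
  · rw [Finset.insert_erase (Finset.min'_mem _ _)]
  · intro b hb; exact Finset.min'_lt_of_mem_erase_min' _ _ hb
  · rw [Finset.card_erase_of_mem (Finset.min'_mem _ _)]; omega

lemma fib_three {i : ZMod m} (h : fib x i = 3) : ∃ a b c : ℕ, a < b ∧ b < c ∧ c < m ∧
    ∀ t : ℕ, t < m → (x (t : ZMod m) = x i ↔ t = a ∨ t = b ∨ t = c) := by
  rw [fib_range] at h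
  obtain ⟨a, T, hS, ha, hT⟩ := card_peel h
  obtain ⟨b, T, rfl, hb, hT⟩ := card_peel hT
  obtain ⟨c, T, rfl, hc, hT⟩ := card_peel hT
  rw [Finset.card_eq_zero] at hT; subst hT
  have hmem : ∀ t : ℕ, (t < m ∧ x (t : ZMod m) = x i) ↔ t = a ∨ t = b ∨ t = c := by
    intro t
    have := Finset.ext_iff.1 hS t
    simpa using this
  refine ⟨a, b, c, ha b (by simp), hb c (by simp), ((hmem c).2 (by simp)).1, ?_⟩
  intro t ht
  rw [← hmem]; simp [ht]

lemma fib_four {i : ZMod m} (h : fib x i = 4) : ∃ a b c d : ℕ, a < b ∧ b < c ∧ c < d ∧ d < m ∧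
    ∀ t : ℕ, t < m → (x (t : ZMod m) = x i ↔ t = a ∨ t = b ∨ t = c ∨ t = d) := by
  rw [fib_range] at h
  obtain ⟨a, T, hS, ha, hT⟩ := card_peel h
  obtain ⟨b, T, rfl, hb, hT⟩ := card_peel hT
  obtain ⟨c, T, rfl, hc, hT⟩ := card_peel hT
  obtain ⟨d, T, rfl, hd, hT⟩ := card_peel hT
  rw [Finset.card_eq_zero] at hT; subst hT
  have hmem : ∀ t : ℕ, (t < m ∧ x (t : ZMod m) = x i) ↔ t = a ∨ t = b ∨ t = c ∨ t = d := by
    intro t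
    have := Finset.ext_iff.1 hS t
    simpa using this
  refine ⟨a, b, c, d, ha b (by simp), hb c (by simp), hc d (by simp),
    ((hmem d).2 (by simp)).1, ?_⟩
  intro t ht
  rw [← hmem]; simp [ht]

lemma tau_ne (h : UValid x) {τ : Equiv.Perm (ZMod m)}
    (hτ : ∀ i, x (τ i) = x i ∧ x (τ i - 1) = x (i + 1)) (i : ZMod m) : τ i ≠ i := by
  intro hc
  have := (hτ i).2
  rw [hc] at this
  exact nb_sub h i this

lemma two_le_fib (h : UValid x) (i : ZMod m) : 2 ≤ fib x i := by
  obtain ⟨τ, hτ⟩ := h.2.2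
  have : ({i, τ i} : Finset (ZMod m)) ⊆ Finset.univ.filter (fun j => x j = x i) := by
    intro a ha
    simp only [Finset.mem_insert, Finset.mem_singleton] at ha
    rcases ha with rfl | rfl <;> simp [hτ]
  have h2 := Finset.card_le_card this
  rwa [Finset.card_pair (tau_ne h hτ i).symm] at h2

/-- Fiber cardinality as a function of the vertex. -/
lemma sum_fib : ∑ y ∈ Finset.univ.image x, (Finset.univ.filter (fun j => x j = y)).card = m := by
  rw [← Finset.card_eq_sum_card_image, Finset.card_univ, ZMod.card]

lemma sum_excess (h : UValid x) :
    ∑ y ∈ Finset.univ.image x, ((Finset.univ.filter (fun j => x j = y)).card - 2)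
      + 2 * (Finset.univ.image x).card = m := by
  conv_rhs => rw [← sum_fib (x := x)]
  rw [mul_comm, ← smul_eq_mul, ← Finset.sum_const, ← Finset.sum_add_distrib]
  apply Finset.sum_congr rfl
  intro y hy
  obtain ⟨i, -, rfl⟩ := Finset.mem_image.1 hy
  have := two_le_fib h i
  unfold fib at this
  omega

lemma gap (h : UValid x) {p : ZMod m} {s r : ℕ} (hs : 0 < s) (hr : 0 < r) (hsr : s + r < m)
    (h0 : x p = x (p + s)) (h0' : x p = x (p + (s + r : ℕ)))
    (e1 : x (p + 1) = x (p + (s + r : ℕ) - 1)) (e2 : x (p + (s + r : ℕ) + 1) = x (p + s - 1)) :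
    ∃ t : ℕ, 0 < t ∧ t < s ∧ fib x (p + t) ≠ 2 := by
  by_contra hcon
  push Not at hcon
  have rf := reflect h h0' e1 s (fun t h1 h2 => Or.inl (hcon t h1 h2))
  have hs1 : s ≠ 1 := by
    rintro rfl; exact h.1 p (by simpa using h0)
  obtain ⟨c, rfl⟩ : ∃ c, s = c + 1 := ⟨s - 1, by omega⟩
  have hi := hcon c (by omega) (by omega)
  have hj : x (p + (r + 1 : ℕ)) = x (p + c) := by
    rw [rf c (by omega)]; congr 1; push_cast; ring
  have hk : x (p + (c + 1 + r + 1 : ℕ)) = x (p + c) := by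
    convert e2 using 2 <;> push_cast <;> ring
  have hji : p + ((r + 1 : ℕ) : ZMod m) ≠ p + c := by
    intro hc
    have := cast_inj' (by omega) (by omega) (add_left_cancel hc)
    obtain ⟨t, t', h1, h2, h3, -, h5⟩ := adj h (by omega) h0' e1
    exact h5 (hcon t h1 (by omega))
  have hki : p + ((c + 1 + r + 1 : ℕ) : ZMod m) ≠ p + c := by
    intro hc
    have h1 := add_left_cancel hc
    have h2 : ((r + 2 : ℕ) : ZMod m) = (0 : ℕ) := by
      push_cast at h1 ⊢; linear_combination h1
    have := cast_inj' (by omega) (by omega) h2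
    omega
  have hjk := add_left_cancel (fib_two_eq hi hj hk hji hki)
  have h2 : ((c + 1 : ℕ) : ZMod m) = (0 : ℕ) := by
    push_cast at hjk ⊢; linear_combination -hjk
  have := cast_inj' (by omega) (by omega) h2
  omega

/-- The number of distinct vertices is at most `n - 1`. -/
lemma card_image_lt (h : UValid x) {n : ℕ} (hm : m = 2 * n) : (Finset.univ.image x).card < n := by
  have hs := sum_excess h
  by_contra hc
  have h0 : ∑ y ∈ Finset.univ.image x, ((Finset.univ.filter (fun j => x j = y)).card - 2) = 0 := by
    omega
  rw [Finset.sum_eq_zero_iff] at h0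
  have hall : ∀ i, fib x i = 2 := by
    intro i
    have := h0 (x i) (Finset.mem_image_of_mem _ (Finset.mem_univ _))
    have := two_le_fib h i
    unfold fib at *; omega
  obtain ⟨τ, hτ⟩ := h.2.2
  obtain ⟨s, hs, hsτ⟩ := exists_nat (τ 0)
  have hne := tau_ne h hτ 0
  have hs0 : s ≠ 0 := by rintro rfl; apply hne; rw [← hsτ]; simp
  obtain ⟨t, t', h1, h2, h3, -, h5⟩ := adj h (p := 0) (s := s) (by omega)
    (by rw [zero_add, hsτ, (hτ 0).1]) (by rw [zero_add, hsτ, zero_add, (hτ 0).2, zero_add])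
  exact h5 (hall _)

lemma sum_two {ι : Type*} [DecidableEq ι] (R : Finset ι) (g : ι → ℕ) (h : ∑ y ∈ R, g y = 2) :
    (∃ a ∈ R, g a = 2 ∧ ∀ b ∈ R, b ≠ a → g b = 0) ∨
    (∃ a ∈ R, ∃ c ∈ R, a ≠ c ∧ g a = 1 ∧ g c = 1 ∧ ∀ b ∈ R, b ≠ a → b ≠ c → g b = 0) := by
  have hex : ∃ a ∈ R, g a ≠ 0 := by
    by_contra hc; push Not at hc
    rw [Finset.sum_eq_zero hc] at h; omega
  obtain ⟨a, ha, hga⟩ := hex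
  rw [← Finset.add_sum_erase R g ha] at h
  by_cases h2 : g a = 2
  · left
    refine ⟨a, ha, h2, fun b hb hba => ?_⟩
    have : ∑ y ∈ R.erase a, g y = 0 := by omega
    rw [Finset.sum_eq_zero_iff] at this
    exact this b (Finset.mem_erase.2 ⟨hba, hb⟩)
  · right
    have h1 : ∑ y ∈ R.erase a, g y = 1 := by omega
    have hex : ∃ c ∈ R.erase a, g c ≠ 0 := by
      by_contra hc; push Not at hc
      rw [Finset.sum_eq_zero hc] at h1; omega
    obtain ⟨c, hc, hgc⟩ := hex
    rw [← Finset.add_sum_erase _ g hc] at h1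
    have h0 : ∑ y ∈ (R.erase a).erase c, g y = 0 := by omega
    rw [Finset.sum_eq_zero_iff] at h0
    refine ⟨a, ha, c, Finset.mem_of_mem_erase hc, (Finset.ne_of_mem_erase hc).symm, by omega,
      by omega, fun b hb hba hbc => ?_⟩
    exact h0 b (Finset.mem_erase.2 ⟨hbc, Finset.mem_erase.2 ⟨hba, hb⟩⟩)

lemma dist_cases (h : UValid x) {n : ℕ} (hm : m = 2 * n)
    (hc : (Finset.univ.image x).card + 1 = n) :
    (∃ i, fib x i = 4 ∧ ∀ j, x j ≠ x i → fib x j = 2) ∨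
    (∃ i j, x i ≠ x j ∧ fib x i = 3 ∧ fib x j = 3 ∧
      ∀ l, x l ≠ x i → x l ≠ x j → fib x l = 2) := by
  have hs := sum_excess h
  have h2 := two_le_fib h
  have hmem : ∀ i, x i ∈ Finset.univ.image x :=
    fun i => Finset.mem_image_of_mem _ (Finset.mem_univ _)
  unfold fib at *
  rcases sum_two (Finset.univ.image x)
    (fun y => (Finset.univ.filter (fun j => x j = y)).card - 2) (by omega) with
    ⟨a, ha, hga, hr⟩ | ⟨a, ha, c, hc, hac, hga, hgc, hr⟩
  · left
    obtain ⟨i, -, rfl⟩ := Finset.mem_image.1 ha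
    refine ⟨i, by omega, fun j hj => ?_⟩
    have := hr (x j) (hmem j) hj
    have := h2 j
    omega
  · right
    obtain ⟨i, -, rfl⟩ := Finset.mem_image.1 ha
    obtain ⟨j, -, rfl⟩ := Finset.mem_image.1 hc
    refine ⟨i, j, hac, by omega, by omega, fun l h1 h3 => ?_⟩
    have := hr (x l) (hmem l) h1 h3
    have := h2 l
    omega

/-- number of positions of multiplicity 3 and 4 -/
lemma break_counts (h : UValid x) {n : ℕ} (hm : m = 2 * n)
    (hc : (Finset.univ.image x).card + 1 = n) :
    ((Finset.univ.filter (fun i => fib x i = 3)).card = 6 ∧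
      (Finset.univ.filter (fun i => fib x i = 4)).card = 0) ∨
    ((Finset.univ.filter (fun i => fib x i = 3)).card = 0 ∧
      (Finset.univ.filter (fun i => fib x i = 4)).card = 4) := by
  rcases dist_cases h hm hc with ⟨i, hi, hr⟩ | ⟨i, j, hij, hi, hj, hr⟩
  · right
    constructor
    · rw [Finset.card_eq_zero, Finset.filter_eq_empty_iff]
      intro l _ hl
      by_cases hx : x l = x i
      · rw [fib_congr hx] at hl; omega
      · rw [hr l hx] at hl; omega
    · rw [← hi]
      conv_rhs => unfold fib
      congr 1
      ext l
      simp only [Finset.mem_filter, Finset.mem_univ, true_and]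
      constructor
      · intro hl
        by_contra hx
        rw [hr l hx] at hl; omega
      · intro hx; exact fib_congr hx
  · left
    constructor
    · have : Finset.univ.filter (fun l => fib x l = 3)
        = Finset.univ.filter (fun l => x l = x i) ∪ Finset.univ.filter (fun l => x l = x j) := by
        ext l
        simp only [Finset.mem_filter, Finset.mem_univ, true_and, Finset.mem_union]
        constructor
        · intro hl
          by_contra hx
          push Not at hx
          rw [hr l hx.1 hx.2] at hl; omega
        · rintro (hx | hx)
          · rw [fib_congr hx, hi]
          · rw [fib_congr hx, hj]
      rw [this, Finset.card_union_of_disjoint]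
      · unfold fib at hi hj; omega
      · rw [Finset.disjoint_filter]
        intro l _ h1 h2
        exact hij (h1.symm.trans h2)
    · rw [Finset.card_eq_zero, Finset.filter_eq_empty_iff]
      intro l _ hl
      by_cases hx : x l = x i
      · rw [fib_congr hx] at hl; omega
      · by_cases hx' : x l = x j
        · rw [fib_congr hx'] at hl; omega
        · rw [hr l hx hx'] at hl; omega

end comb2



section comb3
variable {m : ℕ} [NeZero m] {V : Type*} [DecidableEq V] {x : ZMod m → V}

/-- the step relation in natural coordinates -/
lemma tau_nat {τ : Equiv.Perm (ZMod m)}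
    (hτ : ∀ i, x (τ i) = x i ∧ x (τ i - 1) = x (i + 1)) {p q : ℕ}
    (h : τ (p : ZMod m) = (q : ZMod m)) :
    x (p : ZMod m) = x (q : ZMod m) ∧ x ((p : ZMod m) + 1) = x ((q : ZMod m) - 1) := by
  rw [← h]; exact ⟨(hτ p).1.symm, (hτ p).2.symm⟩

lemma adj_nat (h : UValid x) {p q : ℕ} (hpq : p < q)
    (e : x (p : ZMod m) = x (q : ZMod m) ∧ x ((p : ZMod m) + 1) = x ((q : ZMod m) - 1)) :
    ∃ t t' : ℕ, p < t ∧ t < t' ∧ t' < q ∧ x (t : ZMod m) = x (t' : ZMod m) ∧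
      fib x (t : ZMod m) ≠ 2 := by
  have hq : (q : ZMod m) = (p : ZMod m) + ((q - p : ℕ) : ZMod m) := by
    rw [Nat.cast_sub hpq.le]; ring
  obtain ⟨t, t', h1, h2, h3, h4, h5⟩ := adj h (p := (p : ZMod m)) (s := q - p) (by omega)
    (by rw [← hq]; exact e.1) (by rw [← hq]; exact e.2)
  refine ⟨p + t, p + t', by omega, by omega, by omega, ?_, ?_⟩
  · push_cast; exact h4
  · push_cast; exact h5

lemma arc_nat (h : UValid x) {p q a b : ℕ}
    (e : x (p : ZMod m) = x (q : ZMod m) ∧ x ((p : ZMod m) + 1) = x ((q : ZMod m) - 1))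
    (ha : p < a) (hb : b < q)
    (hfa : ∀ t : ℕ, p < t → t < a → fib x (t : ZMod m) = 2) (hfa' : fib x (a : ZMod m) ≠ 2)
    (hfb : ∀ t : ℕ, b < t → t < q → fib x (t : ZMod m) = 2) (hfb' : fib x (b : ZMod m) ≠ 2) :
    a + b = p + q ∧ ∀ s t : ℕ, p ≤ s → s ≤ a → s + t = p + q → x (s : ZMod m) = x (t : ZMod m) := by
  have := arc h (p := (p : ZMod m)) (q := (q : ZMod m)) e.1 e.2 (a := a - p) (b := q - b)
    (by omega) (by omega)
    (fun t h1 h2 => by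
      have := hfa (p + t) (by omega) (by omega)
      push_cast at this; exact this)
    (by rw [Nat.cast_sub ha.le]; convert hfa' using 2; ring)
    (fun t h1 h2 => by
      have := hfb (q - t) (by omega) (by omega)
      rw [Nat.cast_sub (by omega)] at this; exact this)
    (by rw [Nat.cast_sub hb.le]; convert hfb' using 2; ring)
  refine ⟨by omega, fun s t h1 h2 h3 => ?_⟩
  have h4 := this.2 (s - p) (by omega)
  have ht : (t : ZMod m) = (p : ZMod m) + (q : ZMod m) - (s : ZMod m) := by
    have : ((s + t : ℕ) : ZMod m) = ((p + q : ℕ) : ZMod m) := by rw [h3]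
    push_cast at this; linear_combination this
  rw [Nat.cast_sub h1] at h4
  convert h4 using 2
  · ring
  · rw [ht]; ring

lemma gap_nat (h : UValid x) {p u v : ℕ} (hu : p < u) (hv : u < v) (hvm : v < p + m)
    (e0 : x (p : ZMod m) = x (u : ZMod m))
    (e1 : x (p : ZMod m) = x (v : ZMod m) ∧ x ((p : ZMod m) + 1) = x ((v : ZMod m) - 1))
    (e2 : x (v : ZMod m) = x (u : ZMod m) ∧ x ((v : ZMod m) + 1) = x ((u : ZMod m) - 1)) :
    ∃ t : ℕ, p < t ∧ t < u ∧ fib x (t : ZMod m) ≠ 2 := by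
  have hu' : (u : ZMod m) = (p : ZMod m) + ((u - p : ℕ) : ZMod m) := by
    rw [Nat.cast_sub hu.le]; ring
  have hv' : (v : ZMod m) = (p : ZMod m) + ((u - p + (v - u) : ℕ) : ZMod m) := by
    rw [Nat.cast_add, Nat.cast_sub hu.le, Nat.cast_sub hv.le]; ring
  obtain ⟨t, h1, h2, h3⟩ := gap h (p := (p : ZMod m)) (s := u - p) (r := v - u) (by omega)
    (by omega) (by omega) (by rw [← hu']; exact e0) (by rw [← hv']; exact e1.1)
    (by rw [← hv']; exact e1.2) (by rw [← hv', ← hu']; exact e2.2)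
  exact ⟨p + t, by omega, by omega, by push_cast; exact h3⟩

lemma struct_four (h : UValid x) {n : ℕ} (hm : m = 2 * n)
    (hc : (Finset.univ.image x).card + 1 = n) (hf : fib x 0 = 4) :
    ∃ a c : ℕ, 3 ≤ a ∧ 3 ≤ c ∧ a + c = n ∧
      x (0 : ℕ) = x (a : ℕ) ∧ x (0 : ℕ) = x (n : ℕ) ∧ x (0 : ℕ) = x ((n + a : ℕ) : ZMod m) ∧
      (∀ s t : ℕ, s ≤ a → s + t = n + a → x (s : ZMod m) = x (t : ZMod m)) ∧
      (∀ s t : ℕ, a ≤ s → s ≤ n → s + t = a + 2 * n → x (s : ZMod m) = x (t : ZMod m)) := by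
  have hbr : ∀ j, fib x j ≠ 2 → x j = x 0 := by
    rcases dist_cases h hm hc with ⟨i, hi, hr⟩ | ⟨i, j, hij, hi, hj, hr⟩
    · have : x 0 = x i := by
        by_contra hne
        rw [hr 0 hne] at hf; omega
      intro j hj
      rw [this]; by_contra hne
      exact hj (hr j hne)
    · exfalso
      by_cases h1 : x 0 = x i
      · rw [fib_congr h1] at hf; omega
      · by_cases h2 : x 0 = x j
        · rw [fib_congr h2] at hf; omega
        · rw [hr 0 h1 h2] at hf; omega
  obtain ⟨z, u, v, w, hzu, huv, hvw, hwm, hfib⟩ := fib_four hf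
  have hz : z = 0 := by
    have := (hfib 0 (by omega)).1 (by simp)
    omega
  subst hz
  have h2 : ∀ t : ℕ, t < m → t ≠ 0 → t ≠ u → t ≠ v → t ≠ w → fib x (t : ZMod m) = 2 := by
    intro t ht h1 h2 h3 h4
    by_contra hne
    have := (hfib t ht).1 (hbr _ hne)
    omega
  have xe : ∀ t : ℕ, t < m → (t = 0 ∨ t = u ∨ t = v ∨ t = w) → x (t : ZMod m) = x 0 :=
    fun t ht h => (hfib t ht).2 h
  have h4 : ∀ t : ℕ, t < m → (t = 0 ∨ t = u ∨ t = v ∨ t = w) → fib x (t : ZMod m) ≠ 2 := by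
    intro t ht h
    rw [fib_congr (xe t ht h), hf]; omega
  obtain ⟨τ, hτ⟩ := h.2.2
  have key : ∀ p : ℕ, p < m → (p = 0 ∨ p = u ∨ p = v ∨ p = w) →
      ∃ q : ℕ, q < m ∧ (q = 0 ∨ q = u ∨ q = v ∨ q = w) ∧ q ≠ p ∧ τ p = q := by
    intro p hp hp'
    obtain ⟨q, hq, hqτ⟩ := exists_nat (τ p)
    refine ⟨q, hq, ?_, ?_, hqτ.symm⟩
    · apply (hfib q hq).1
      rw [hqτ, (hτ p).1, xe p hp hp']
    · rintro rfl
      exact tau_ne h hτ _ hqτ.symm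
  have castm : ((m : ℕ) : ZMod m) = ((0 : ℕ) : ZMod m) := by simp
  -- a forward match must skip at least two special positions
  have fw : ∀ p q : ℕ, p < q → q ≤ m →
      (x (p : ZMod m) = x (q : ZMod m) ∧ x ((p : ZMod m) + 1) = x ((q : ZMod m) - 1)) →
      ∃ t t' : ℕ, p < t ∧ t < t' ∧ t' < q ∧ (t = u ∨ t = v ∨ t = w) ∧
        (t' = u ∨ t' = v ∨ t' = w) := by
    intro p q hpq hq e
    obtain ⟨t, t', h1, h3, h5, h6, h7⟩ := adj_nat h hpq e
    refine ⟨t, t', h1, h3, h5, ?_, ?_⟩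
    · by_contra hcon; exact h7 (h2 t (by omega) (by omega) (by omega) (by omega) (by omega))
    · rw [fib_congr h6] at h7
      by_contra hcon; exact h7 (h2 t' (by omega) (by omega) (by omega) (by omega) (by omega))
  obtain ⟨q0, hq0, hq0', hq0n, eq0⟩ := key 0 (by omega) (by simp)
  obtain ⟨q1, hq1, hq1', hq1n, eq1⟩ := key u (by omega) (by simp)
  have d01 : q0 ≠ q1 := by
    rintro rfl
    have := τ.injective (eq0.trans eq1.symm)
    have := cast_inj' (by omega) (by omega) this
    omega
  have E0 := tau_nat hτ eq0
  have E1 := tau_nat hτ eq1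
  have hq0w : q0 = w := by
    obtain ⟨t, t', _⟩ := fw 0 q0 (by omega) (by omega) E0
    omega
  have hq10 : q1 = 0 := by
    by_contra hne
    rcases Nat.lt_or_ge u q1 with hlt | hge
    · obtain ⟨t, t', _⟩ := fw u q1 (by omega) (by omega) E1
      omega
    · omega
  subst hq0w hq10
  have A0 := arc_nat h E0 (a := u) (b := v) (by omega) (by omega)
    (fun t _ _ => h2 t (by omega) (by omega) (by omega) (by omega) (by omega)) (h4 u (by omega) (by simp))
    (fun t _ _ => h2 t (by omega) (by omega) (by omega) (by omega) (by omega)) (h4 v (by omega) (by simp))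
  rw [← castm] at E1
  have A1 := arc_nat h E1 (a := v) (b := q0) (by omega) (by omega)
    (fun t _ _ => h2 t (by omega) (by omega) (by omega) (by omega) (by omega)) (h4 v (by omega) (by simp))
    (fun t _ _ => h2 t (by omega) (by omega) (by omega) (by omega) (by omega)) (h4 q0 (by omega) (by simp))
  have hv : v = n := by omega
  have hw : q0 = n + u := by omega
  have n3 : ∀ p q : ℕ, p < q → q ≤ m → x (p : ZMod m) = x (q : ZMod m) → p + 3 ≤ q := by
    intro p q hpq hq e
    by_contra hcon
    rcases (by omega : q = p + 1 ∨ q = p + 2) with rfl | rfl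
    · exact h.1 p (by push_cast at e; exact e)
    · exact h.2.1 p (by push_cast at e; exact e)
  have b1 := n3 0 u (by omega) (by omega) (by rw [xe u (by omega) (by simp)]; simp)
  have b2 := n3 u v (by omega) (by omega)
    (by rw [xe u (by omega) (by simp), xe v (by omega) (by simp)])
  subst hv hw
  refine ⟨u, v - u, by omega, by omega, by omega, ?_, ?_, ?_, ?_, ?_⟩
  · rw [xe u (by omega) (by simp)]; simp
  · rw [xe v (by omega) (by simp)]; simp
  · rw [xe (v + u) (by omega) (by simp)]; simp
  · intro s t hs hst
    exact A0.2 s t (by omega) hs (by omega)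
  · intro s t h1 h3 h5
    exact A1.2 s t h1 h3 (by omega)

lemma struct_three (h : UValid x) {n : ℕ} (hm : m = 2 * n)
    (hc : (Finset.univ.image x).card + 1 = n) (hf : fib x 0 = 3) :
    ∃ a b c : ℕ, 1 ≤ a ∧ 1 ≤ b ∧ 1 ≤ c ∧ a + b + c = n ∧ 3 ≤ a + b ∧ 3 ≤ b + c ∧ 3 ≤ a + c ∧
      x (0 : ℕ) = x ((a + b : ℕ) : ZMod m) ∧ x (0 : ℕ) = x ((n + a : ℕ) : ZMod m) ∧
      x (a : ℕ) = x (n : ℕ) ∧ x (a : ℕ) = x ((n + a + b : ℕ) : ZMod m) ∧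
      (∀ s t : ℕ, s ≤ a → s + t = n + a → x (s : ZMod m) = x (t : ZMod m)) ∧
      (∀ s t : ℕ, a ≤ s → s ≤ a + b → s + t = n + 2 * a + b → x (s : ZMod m) = x (t : ZMod m)) ∧
      (∀ s t : ℕ, a + b ≤ s → s ≤ n → s + t = a + b + 2 * n → x (s : ZMod m) = x (t : ZMod m)) := by
  have hbr : ∃ j, x j ≠ x 0 ∧ fib x j = 3 ∧ ∀ l, x l ≠ x 0 → x l ≠ x j → fib x l = 2 := by
    rcases dist_cases h hm hc with ⟨i, hi, hr⟩ | ⟨i, j, hij, hi, hj, hr⟩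
    · exfalso
      by_cases h1 : x 0 = x i
      · rw [fib_congr h1] at hf; omega
      · rw [hr 0 h1] at hf; omega
    · by_cases h1 : x 0 = x i
      · exact ⟨j, by rw [h1]; exact hij.symm, hj, by rw [h1]; exact hr⟩
      · by_cases h2 : x 0 = x j
        · exact ⟨i, by rw [h2]; exact hij, hi, by rw [h2]; exact fun l h1 h2 => hr l h2 h1⟩
        · rw [hr 0 h1 h2] at hf; omega
  obtain ⟨j, hj0, hj3, hr⟩ := hbr
  obtain ⟨z, u, v, hzu, huv, hvm, hfib⟩ := fib_three hf
  obtain ⟨f1, f2, f3, hf12, hf23, hf3m, hfib'⟩ := fib_three hj3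
  have hz : z = 0 := by
    have := (hfib 0 (by omega)).1 (by simp)
    omega
  subst hz
  have h2 : ∀ t : ℕ, t < m → t ≠ 0 → t ≠ u → t ≠ v → t ≠ f1 → t ≠ f2 → t ≠ f3 →
      fib x (t : ZMod m) = 2 := by
    intro t ht h1 h2 h3 h4 h5 h6
    apply hr
    · intro hc; have := (hfib t ht).1 hc; omega
    · intro hc; have := (hfib' t ht).1 hc; omega
  have xe : ∀ t : ℕ, t < m → (t = 0 ∨ t = u ∨ t = v) → x (t : ZMod m) = x 0 :=
    fun t ht h => (hfib t ht).2 h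
  have xe' : ∀ t : ℕ, t < m → (t = f1 ∨ t = f2 ∨ t = f3) → x (t : ZMod m) = x j :=
    fun t ht h => (hfib' t ht).2 h
  have h4 : ∀ t : ℕ, t < m → (t = 0 ∨ t = u ∨ t = v) → fib x (t : ZMod m) ≠ 2 := by
    intro t ht h
    rw [fib_congr (xe t ht h), hf]; omega
  have h4' : ∀ t : ℕ, t < m → (t = f1 ∨ t = f2 ∨ t = f3) → fib x (t : ZMod m) ≠ 2 := by
    intro t ht h
    rw [fib_congr (xe' t ht h), hj3]; omega
  have hdis : ∀ t : ℕ, t < m → (t = 0 ∨ t = u ∨ t = v) → (t = f1 ∨ t = f2 ∨ t = f3) → False := by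
    intro t ht h h'
    exact hj0 ((xe' t ht h').symm.trans (xe t ht h))
  obtain ⟨τ, hτ⟩ := h.2.2
  have key : ∀ p : ℕ, p < m → (p = 0 ∨ p = u ∨ p = v) →
      ∃ q : ℕ, q < m ∧ (q = 0 ∨ q = u ∨ q = v) ∧ q ≠ p ∧ τ p = q := by
    intro p hp hp'
    obtain ⟨q, hq, hqτ⟩ := exists_nat (τ p)
    refine ⟨q, hq, ?_, ?_, hqτ.symm⟩
    · apply (hfib q hq).1
      rw [hqτ, (hτ p).1, xe p hp hp']
    · rintro rfl
      exact tau_ne h hτ _ hqτ.symm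
  have castm : ((m : ℕ) : ZMod m) = ((0 : ℕ) : ZMod m) := by simp
  have fw : ∀ p q : ℕ, p < q → q ≤ m →
      (x (p : ZMod m) = x (q : ZMod m) ∧ x ((p : ZMod m) + 1) = x ((q : ZMod m) - 1)) →
      ∃ t t' : ℕ, p < t ∧ t < t' ∧ t' < q ∧ (t = u ∨ t = v ∨ t = f1 ∨ t = f2 ∨ t = f3) ∧
        (t' = u ∨ t' = v ∨ t' = f1 ∨ t' = f2 ∨ t' = f3) := by
    intro p q hpq hq e
    obtain ⟨t, t', h1, h3, h5, h6, h7⟩ := adj_nat h hpq e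
    refine ⟨t, t', h1, h3, h5, ?_, ?_⟩
    · by_contra hcon
      exact h7 (h2 t (by omega) (by omega) (by omega) (by omega) (by omega) (by omega) (by omega))
    · rw [fib_congr h6] at h7
      by_contra hcon
      exact h7 (h2 t' (by omega) (by omega) (by omega) (by omega) (by omega) (by omega) (by omega))
  obtain ⟨q0, hq0, hq0', hq0n, eq0⟩ := key 0 (by omega) (by simp)
  obtain ⟨q1, hq1, hq1', hq1n, eq1⟩ := key u (by omega) (by simp)
  obtain ⟨q2, hq2, hq2', hq2n, eq2⟩ := key v (by omega) (by simp)
  have dd : ∀ p p' q q' : ℕ, p < m → p' < m → τ (p : ZMod m) = (q : ZMod m) →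
      τ (p' : ZMod m) = (q' : ZMod m) → p ≠ p' → q ≠ q' := by
    rintro p p' q q' hp hp' e e' hne rfl
    have := τ.injective (e.trans e'.symm)
    exact hne (cast_inj' hp hp' this)
  have d01 := dd _ _ _ _ (by omega) (by omega) eq0 eq1 (by omega)
  have d02 := dd _ _ _ _ (by omega) (by omega) eq0 eq2 (by omega)
  have d12 := dd _ _ _ _ (by omega) (by omega) eq1 eq2 (by omega)
  have E0 := tau_nat hτ eq0
  have E1 := tau_nat hτ eq1
  have E2 := tau_nat hτ eq2
  have hq0v : q0 = v := by
    by_contra hne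
    have hq0u : q0 = u := by omega
    have hq1v : q1 = v := by omega
    subst hq0u hq1v
    obtain ⟨t, t', _⟩ := fw 0 q0 (by omega) (by omega) E0
    obtain ⟨s, s', _⟩ := fw q0 q1 (by omega) (by omega) E1
    omega
  have hq10 : q1 = 0 := by omega
  have hq2u : q2 = u := by omega
  subst hq0v hq10 hq2u
  have castu : ((m + q2 : ℕ) : ZMod m) = ((q2 : ℕ) : ZMod m) := by simp
  have castv : ((m + q0 : ℕ) : ZMod m) = ((q0 : ℕ) : ZMod m) := by simp
  have E1m := E1
  rw [← castm] at E1m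
  have hq2m : q2 < m := by omega
  have d1 := hdis q2 hq2m (by simp)
  have d2 := hdis q0 hvm (by simp)
  have d3 := hdis 0 (by omega) (by simp)
  have cl : ∀ t : ℕ, t < m → fib x (t : ZMod m) ≠ 2 → t = 0 ∨ t = q2 ∨ t = q0 ∨ t = f1 ∨ t = f2 ∨
      t = f3 := by
    intro t ht hne
    by_contra hcon
    exact hne (h2 t ht (by omega) (by omega) (by omega) (by omega) (by omega) (by omega))
  obtain ⟨t1, t1a, t1b, t1c⟩ := gap_nat h (p := 0) (u := q2) (v := q0) (by omega) (by omega)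
    (by omega) (by rw [xe q2 (by omega) (by simp)]; simp) E0 E2
  obtain ⟨t2, t2a, t2b, t2c⟩ := gap_nat h (p := q2) (u := q0) (v := m) (by omega) (by omega)
    (by omega) E2.1.symm E1m (by rw [castm]; exact E0)
  obtain ⟨t3, t3a, t3b, t3c⟩ := gap_nat h (p := q0) (u := m) (v := m + q2) (by omega) (by omega)
    (by omega) (by rw [castm]; exact E0.1.symm) (by rw [castu]; exact E2)
    (by rw [castu]; exact E1m)
  have c1 := cl t1 (by omega) t1c
  have c2 := cl t2 (by omega) t2c
  have c3 := cl t3 (by omega) t3c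
  have o1 : 0 < f1 ∧ f1 < q2 ∧ q2 < f2 ∧ f2 < q0 ∧ q0 < f3 := by omega
  clear c1 c2 c3 t1c t2c t3c fw key
  have A0 := arc_nat h E0 (a := f1) (b := f2) (by omega) (by omega)
    (fun t _ _ => h2 t (by omega) (by omega) (by omega) (by omega) (by omega) (by omega) (by omega))
    (h4' f1 (by omega) (by simp))
    (fun t _ _ => h2 t (by omega) (by omega) (by omega) (by omega) (by omega) (by omega) (by omega))
    (h4' f2 (by omega) (by simp))
  have A1 := arc_nat h E1m (a := f2) (b := f3) (by omega) (by omega)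
    (fun t _ _ => h2 t (by omega) (by omega) (by omega) (by omega) (by omega) (by omega) (by omega))
    (h4' f2 (by omega) (by simp))
    (fun t _ _ => h2 t (by omega) (by omega) (by omega) (by omega) (by omega) (by omega) (by omega))
    (h4' f3 (by omega) (by simp))
  have A2 := arc_nat h E2 (a := f3) (b := f1) (by omega) (by omega)
    (fun t _ _ => h2 t (by omega) (by omega) (by omega) (by omega) (by omega) (by omega) (by omega))
    (h4' f3 (by omega) (by simp))
    (fun t _ _ => h2 t (by omega) (by omega) (by omega) (by omega) (by omega) (by omega) (by omega))
    (h4' f1 (by omega) (by simp))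
  have n3 : ∀ p q : ℕ, p < q → x (p : ZMod m) = x (q : ZMod m) → p + 3 ≤ q := by
    intro p q hpq e
    by_contra hcon
    rcases (by omega : q = p + 1 ∨ q = p + 2) with rfl | rfl
    · exact h.1 p (by push_cast at e; exact e)
    · exact h.2.1 p (by push_cast at e; exact e)
  have b1 := n3 0 q2 (by omega) (by rw [xe q2 (by omega) (by simp)]; simp)
  have b2 := n3 f1 f2 (by omega) (by rw [xe' f1 (by omega) (by simp), xe' f2 (by omega) (by simp)])
  have b3 := n3 f3 (m + f1) (by omega)
    (by rw [xe' f3 (by omega) (by simp), Nat.cast_add, castm, Nat.cast_zero, zero_add,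
      xe' f1 (by omega) (by simp)])
  have hf2 : f2 = n := by omega
  have hv : q0 = n + f1 := by omega
  have hf3 : f3 = n + q2 := by omega
  subst hf2 hv hf3
  refine ⟨f1, q2 - f1, f2 - q2, by omega, by omega, by omega, by omega, by omega, by omega,
    by omega, ?_, ?_, ?_, ?_, ?_, ?_, ?_⟩
  · rw [show f1 + (q2 - f1) = q2 by omega, xe q2 (by omega) (by simp)]; simp
  · rw [xe (f2 + f1) (by omega) (by simp)]; simp
  · rw [xe' f1 (by omega) (by simp), xe' f2 (by omega) (by simp)]
  · rw [xe' f1 (by omega) (by simp), show f2 + f1 + (q2 - f1) = f2 + q2 by omega,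
      xe' (f2 + q2) (by omega) (by simp)]
  · intro s t hs hst
    exact A0.2 s t (by omega) hs (by omega)
  · intro s t hs hs' hst
    exact (A2.2 t s (by omega) (by omega) (by omega)).symm
  · intro s t h1 h3 h5
    exact A1.2 s t (by omega) h3 (by omega)

end comb3



/-- cyclic successor on `{0, …, m-1}` -/
def nx (m t : ℕ) : ℕ := if t + 1 = m then 0 else t + 1

/-- identification of first-visit positions in the theta pattern -/
def idn3 (n a b r : ℕ) : ℕ := if r = a + b then 0 else if r = n then a else r

/-- theta pattern -/
def pat3 (n a b t : ℕ) : ℕ :=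
  idn3 n a b (if t < n then t else if t ≤ n + a then n + a - t
    else if t ≤ n + a + b then n + 2 * a + b - t else a + b + 2 * n - t)

/-- matching of steps in the theta pattern -/
def sig3 (n a b t : ℕ) : ℕ :=
  if t < a ∨ (n ≤ t ∧ t < n + a) then n + a - 1 - t
  else if t < a + b ∨ (n ≤ t ∧ t < n + a + b) then n + 2 * a + b - 1 - t
  else a + b + 2 * n - 1 - t

/-- identification in the figure-eight pattern -/
def idn4 (n a r : ℕ) : ℕ := if r = a then 0 else if r = n then 0 else r

/-- figure-eight pattern -/
def pat4 (n a t : ℕ) : ℕ :=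
  idn4 n a (if t < n then t else if t ≤ n + a then n + a - t else 2 * n + a - t)

/-- matching of steps in the figure-eight pattern -/
def sig4 (n a t : ℕ) : ℕ :=
  if t < a ∨ (n ≤ t ∧ t < n + a) then n + a - 1 - t else 2 * n + a - 1 - t

/-- what makes a pattern admissible -/
structure PatOK (m : ℕ) (p s : ℕ → ℕ) : Prop where
  nb1 : ∀ t < m, p t ≠ p (nx m t)
  nb2 : ∀ t < m, p t ≠ p (nx m (nx m t))
  slt : ∀ t < m, s t < m
  inv : ∀ t < m, s (s t) = t
  e1 : ∀ t < m, p (s t) = p (nx m t)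
  e2 : ∀ t < m, p (nx m (s t)) = p t

lemma nx_spec (m t : ℕ) : (t + 1 = m ∧ nx m t = 0) ∨ (t + 1 ≠ m ∧ nx m t = t + 1) := by
  unfold nx; split_ifs <;> simp [*]

lemma nx_nx_spec (m t : ℕ) (ht : t < m) (hm : 3 ≤ m) : (t + 2 < m ∧ nx m (nx m t) = t + 2) ∨
    (m ≤ t + 2 ∧ nx m (nx m t) + m = t + 2) := by
  have h1 := nx_spec m t
  have h2 := nx_spec m (nx m t)
  omega

lemma pat3_spec {n a b c : ℕ} (hb : 1 ≤ b) (hn : a + b + c = n) (hc : 1 ≤ c) (t : ℕ) (ht : t < 2 * n) :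
    (t < n ∧ t ≠ a + b ∧ pat3 n a b t = t) ∨ (t = a + b ∧ pat3 n a b t = 0) ∨
    (n ≤ t ∧ t ≤ n + a ∧ pat3 n a b t + t = n + a) ∨
    (n + a < t ∧ t ≤ n + a + b ∧ pat3 n a b t + t = n + 2 * a + b) ∨
    (n + a + b < t ∧ pat3 n a b t + t = a + b + 2 * n) := by
  by_cases h1 : t < n
  · by_cases h2 : t = a + b
    · right; left
      refine ⟨h2, ?_⟩
      simp [pat3, idn3, h2, show a + b < n by omega]
    · left
      refine ⟨h1, h2, ?_⟩
      simp [pat3, idn3, h2, h1, show t ≠ n by omega]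
  · right; right
    unfold pat3 idn3
    rw [if_neg h1]
    by_cases h2 : t ≤ n + a
    · left; rw [if_pos h2]; split_ifs <;> omega
    · rw [if_neg h2]
      right
      by_cases h3 : t ≤ n + a + b
      · left; rw [if_pos h3]; split_ifs <;> omega
      · right; rw [if_neg h3]; split_ifs <;> omega

lemma sig3_spec {n a b c : ℕ} (hn : a + b + c = n) (t : ℕ) (ht : t < 2 * n) :
    ((t < a ∨ (n ≤ t ∧ t < n + a)) ∧ sig3 n a b t + t + 1 = n + a) ∨
    (((a ≤ t ∧ t < a + b) ∨ (n + a ≤ t ∧ t < n + a + b)) ∧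
      sig3 n a b t + t + 1 = n + 2 * a + b) ∨
    (((a + b ≤ t ∧ t < n) ∨ (n + a + b ≤ t)) ∧ sig3 n a b t + t + 1 = a + b + 2 * n) := by
  unfold sig3; split_ifs <;> omega

lemma pat4_spec {n a c : ℕ} (hn : a + c = n) (hc : 1 ≤ c) (t : ℕ) (ht : t < 2 * n) :
    (t < n ∧ t ≠ a ∧ pat4 n a t = t) ∨ (t = a ∧ pat4 n a t = 0) ∨ (t = n ∧ pat4 n a t = 0) ∨
    (n < t ∧ t ≤ n + a ∧ pat4 n a t + t = n + a) ∨
    (n + a < t ∧ pat4 n a t + t = 2 * n + a) := by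
  unfold pat4 idn4; split_ifs <;> omega

lemma sig4_spec {n a c : ℕ} (hn : a + c = n) (t : ℕ) (ht : t < 2 * n) :
    ((t < a ∨ (n ≤ t ∧ t < n + a)) ∧ sig4 n a t + t + 1 = n + a) ∨
    (((a ≤ t ∧ t < n) ∨ (n + a ≤ t)) ∧ sig4 n a t + t + 1 = 2 * n + a) := by
  unfold sig4; split_ifs <;> omega

lemma nx_lt {m t : ℕ} (ht : t < m) : nx m t < m := by
  have := nx_spec m t; omega

lemma patOK3 {n a b c : ℕ} (ha : 1 ≤ a) (hb : 1 ≤ b) (hc : 1 ≤ c) (hn : a + b + c = n)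
    (h1 : 3 ≤ a + b) (h2 : 3 ≤ b + c) (h3 : 3 ≤ a + c) :
    PatOK (2 * n) (pat3 n a b) (sig3 n a b) := by
  have hs : ∀ t < 2 * n, sig3 n a b t < 2 * n := by
    intro t ht; have := sig3_spec hn t ht; omega
  constructor
  · intro t ht
    have e1 := pat3_spec hb hn hc t ht
    have e2 := pat3_spec hb hn hc _ (nx_lt ht)
    have e3 := nx_spec (2 * n) t
    omega
  · intro t ht
    have e1 := pat3_spec hb hn hc t ht
    have e2 := pat3_spec hb hn hc _ (nx_lt (nx_lt ht))
    have e3 := nx_nx_spec (2 * n) t ht (by omega)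
    omega
  · exact hs
  · intro t ht
    have e1 := sig3_spec hn t ht
    have e2 := sig3_spec hn _ (hs t ht)
    omega
  · intro t ht
    have e1 := sig3_spec hn t ht
    have e2 := pat3_spec hb hn hc _ (hs t ht)
    have e3 := nx_spec (2 * n) t
    have e4 := pat3_spec hb hn hc _ (nx_lt ht)
    omega
  · intro t ht
    have e1 := sig3_spec hn t ht
    have e2 := pat3_spec hb hn hc _ ht
    have e3 := nx_spec (2 * n) (sig3 n a b t)
    have e4 := pat3_spec hb hn hc _ (nx_lt (hs t ht))
    omega

lemma patOK4 {n a c : ℕ} (ha : 3 ≤ a) (hc : 3 ≤ c) (hn : a + c = n) :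
    PatOK (2 * n) (pat4 n a) (sig4 n a) := by
  have hc' : 1 ≤ c := by omega
  have hs : ∀ t < 2 * n, sig4 n a t < 2 * n := by
    intro t ht; have := sig4_spec hn t ht; omega
  constructor
  · intro t ht
    have e1 := pat4_spec hn hc' t ht
    have e2 := pat4_spec hn hc' _ (nx_lt ht)
    have e3 := nx_spec (2 * n) t
    omega
  · intro t ht
    have e1 := pat4_spec hn hc' t ht
    have e2 := pat4_spec hn hc' _ (nx_lt (nx_lt ht))
    have e3 := nx_nx_spec (2 * n) t ht (by omega)
    omega
  · exact hs
  · intro t ht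
    have e1 := sig4_spec hn t ht
    have e2 := sig4_spec hn _ (hs t ht)
    omega
  · intro t ht
    have e1 := sig4_spec hn t ht
    have e2 := pat4_spec hn hc' _ (hs t ht)
    have e3 := nx_spec (2 * n) t
    have e4 := pat4_spec hn hc' _ (nx_lt ht)
    omega
  · intro t ht
    have e1 := sig4_spec hn t ht
    have e2 := pat4_spec hn hc' _ ht
    have e3 := nx_spec (2 * n) (sig4 n a t)
    have e4 := pat4_spec hn hc' _ (nx_lt (hs t ht))
    omega



lemma ker_factor {α β γ : Type*} {x : α → β} {q : α → γ} (hq : Function.Surjective q)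
    (h : ∀ i j, x i = x j ↔ q i = q j) : ∃ f : γ ↪ β, x = f ∘ q := by
  have hinj : Function.Injective (fun c => x (Function.surjInv hq c)) := by
    intro c d hcd
    have := (h _ _).1 hcd
    rwa [Function.surjInv_eq hq, Function.surjInv_eq hq] at this
  refine ⟨⟨_, hinj⟩, ?_⟩
  funext i
  exact (h _ _).2 (Function.surjInv_eq hq _).symm

section comb5
variable {m : ℕ} [NeZero m]

/-- walks with the kernel of the pattern `p` -/
def Kset (m : ℕ) [NeZero m] (N : ℕ) (p : ℕ → ℕ) : Finset (ZMod m → Fin N) :=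
  Finset.univ.filter (fun x => ∀ i j : ZMod m, x i = x j ↔ p i.val = p j.val)

/-- the pattern as a surjection -/
def pR (m : ℕ) [NeZero m] (p : ℕ → ℕ) (i : ZMod m) : ((Finset.range m).image p) :=
  ⟨p i.val, Finset.mem_image_of_mem _ (Finset.mem_range.2 (ZMod.val_lt i))⟩

lemma pR_surj (p : ℕ → ℕ) : Function.Surjective (pR m p) := by
  rintro ⟨r, hr⟩
  obtain ⟨t, ht, rfl⟩ := Finset.mem_image.1 hr
  refine ⟨(t : ZMod m), ?_⟩
  simp only [pR, Subtype.mk.injEq]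
  rw [ZMod.val_cast_of_lt (Finset.mem_range.1 ht)]

lemma mem_Kset {N : ℕ} {p : ℕ → ℕ} {x : ZMod m → Fin N} :
    x ∈ Kset m N p ↔ ∃ f : ((Finset.range m).image p) ↪ Fin N, x = f ∘ pR m p := by
  simp only [Kset, Finset.mem_filter, Finset.mem_univ, true_and]
  constructor
  · intro h
    apply ker_factor (pR_surj p)
    intro i j
    rw [h]; simp [pR]
  · rintro ⟨f, rfl⟩ i j
    simp [pR]

lemma card_Kset (N : ℕ) (p : ℕ → ℕ) :
    (Kset m N p).card = N.descFactorial ((Finset.range m).image p).card := by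
  have : (Kset m N p).card = (Finset.univ : Finset (((Finset.range m).image p) ↪ Fin N)).card := by
    symm
    apply Finset.card_bij (fun (f : ((Finset.range m).image p) ↪ Fin N) _ => (f ∘ pR m p : ZMod m → Fin N))
    · intro f _; exact mem_Kset.2 ⟨f, rfl⟩
    · intro f _ g _ hfg
      ext r
      obtain ⟨i, rfl⟩ := pR_surj p r
      have := congrFun hfg i
      simp only [Function.comp] at this
      rw [this]
    · intro x hx
      obtain ⟨f, rfl⟩ := mem_Kset.1 hx
      exact ⟨f, Finset.mem_univ _, rfl⟩
  rw [this, Finset.card_univ, Fintype.card_embedding_eq]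
  simp

lemma card_image_Kset {N : ℕ} {p : ℕ → ℕ} {x : ZMod m → Fin N} (hx : x ∈ Kset m N p) :
    (Finset.univ.image x).card = ((Finset.range m).image p).card := by
  obtain ⟨f, rfl⟩ := mem_Kset.1 hx
  rw [← Finset.image_image, Finset.card_image_of_injective _ f.injective,
    Finset.image_univ_of_surjective (pR_surj p), Finset.card_univ]
  simp

lemma val_nx (i : ZMod m) : (i + 1).val = nx m i.val := by
  have hlt := ZMod.val_lt i
  have h : ((nx m i.val : ℕ) : ZMod m) = i + 1 := by
    rcases nx_spec m i.val with ⟨h1, h2⟩ | ⟨h1, h2⟩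
    · rw [h2]
      have : ((i.val + 1 : ℕ) : ZMod m) = 0 := by rw [h1]; simp
      push_cast at this
      rw [ZMod.natCast_zmod_val] at this
      rw [this]; simp
    · rw [h2]; push_cast; rw [ZMod.natCast_zmod_val]
  rw [← h, ZMod.val_cast_of_lt (nx_lt hlt)]

lemma valid_of_K {N : ℕ} {p s : ℕ → ℕ} (hp : PatOK m p s) {x : ZMod m → Fin N}
    (hx : x ∈ Kset m N p) : UValid x := by
  simp only [Kset, Finset.mem_filter, Finset.mem_univ, true_and] at hx
  have hinv : Function.Involutive (fun i : ZMod m => ((s i.val : ℕ) : ZMod m)) := by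
    intro i
    simp only
    rw [ZMod.val_cast_of_lt (hp.slt _ (ZMod.val_lt i)), hp.inv _ (ZMod.val_lt i),
      ZMod.natCast_zmod_val]
  refine ⟨fun i h => ?_, fun i h => ?_, hinv.toPerm.trans (Equiv.addRight 1), fun i => ⟨?_, ?_⟩⟩
  · rw [hx, val_nx] at h
    exact hp.nb1 _ (ZMod.val_lt i) h
  · rw [hx, show i + 2 = i + 1 + 1 by ring, val_nx, val_nx] at h
    exact hp.nb2 _ (ZMod.val_lt i) h
  · rw [hx]
    simp only [Equiv.trans_apply, Function.Involutive.coe_toPerm, Equiv.coe_addRight]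
    rw [val_nx, ZMod.val_cast_of_lt (hp.slt _ (ZMod.val_lt i)), hp.e2 _ (ZMod.val_lt i)]
  · rw [hx]
    simp only [Equiv.trans_apply, Function.Involutive.coe_toPerm, Equiv.coe_addRight,
      add_sub_cancel_right]
    rw [val_nx, ZMod.val_cast_of_lt (hp.slt _ (ZMod.val_lt i)), hp.e1 _ (ZMod.val_lt i)]

lemma fib_of_K {N : ℕ} {p : ℕ → ℕ} {x : ZMod m → Fin N}
    (hx : x ∈ Kset m N p) : fib x 0 = ((Finset.range m).filter (fun t => p t = p 0)).card := by
  simp only [Kset, Finset.mem_filter, Finset.mem_univ, true_and] at hx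
  rw [fib_range]
  congr 1
  apply Finset.filter_congr
  intro t ht
  rw [hx, ZMod.val_cast_of_lt (Finset.mem_range.1 ht), ZMod.val_zero]

/-- converse: a walk that factors through a pattern with the right number of vertices -/
lemma mem_K_of {N : ℕ} {p : ℕ → ℕ} {x : ZMod m → Fin N}
    (h1 : ∀ t < m, x (t : ZMod m) = x ((p t : ℕ) : ZMod m))
    (hc : (Finset.univ.image x).card = ((Finset.range m).image p).card) : x ∈ Kset m N p := by
  simp only [Kset, Finset.mem_filter, Finset.mem_univ, true_and]
  have himg : Finset.univ.image x
      = ((Finset.range m).image p).image (fun r : ℕ => x (r : ZMod m)) := by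
    ext y
    simp only [Finset.mem_image, Finset.mem_univ, true_and, Finset.mem_range,
      exists_exists_and_eq_and]
    constructor
    · rintro ⟨i, rfl⟩
      refine ⟨i.val, ZMod.val_lt i, ?_⟩
      rw [← h1 _ (ZMod.val_lt i), ZMod.natCast_zmod_val]
    · rintro ⟨t, _, rfl⟩
      exact ⟨_, rfl⟩
  rw [himg] at hc
  have hinj := Finset.card_image_iff.1 hc
  have hx : ∀ i : ZMod m, x i = x ((p i.val : ℕ) : ZMod m) := by
    intro i
    rw [← h1 _ (ZMod.val_lt i), ZMod.natCast_zmod_val]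
  have hmem : ∀ i : ZMod m, p i.val ∈ ((Finset.range m).image p : Finset ℕ) :=
    fun i => Finset.mem_image_of_mem _ (Finset.mem_range.2 (ZMod.val_lt i))
  intro i j
  constructor
  · intro h
    rw [hx i, hx j] at h
    exact hinj (hmem i) (hmem j) h
  · intro h
    rw [hx i, hx j, h]

end comb5

lemma image_pat3 {n a b c : ℕ} (hb : 1 ≤ b) (hc : 1 ≤ c) (hn : a + b + c = n) :
    (Finset.range (2 * n)).image (pat3 n a b) = (Finset.range n).erase (a + b) := by
  ext r
  simp only [Finset.mem_image, Finset.mem_range, Finset.mem_erase]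
  constructor
  · rintro ⟨t, ht, rfl⟩
    have := pat3_spec hb hn hc t ht
    omega
  · rintro ⟨h1, h2⟩
    refine ⟨r, by omega, ?_⟩
    have := pat3_spec hb hn hc r (by omega)
    omega

lemma image_pat4 {n a c : ℕ} (ha : 1 ≤ a) (hc : 1 ≤ c) (hn : a + c = n) :
    (Finset.range (2 * n)).image (pat4 n a) = (Finset.range n).erase a := by
  ext r
  simp only [Finset.mem_image, Finset.mem_range, Finset.mem_erase]
  constructor
  · rintro ⟨t, ht, rfl⟩
    have := pat4_spec hn hc t ht
    omega
  · rintro ⟨h1, h2⟩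
    refine ⟨r, by omega, ?_⟩
    have := pat4_spec hn hc r (by omega)
    omega

lemma card_image_pat3 {n a b c : ℕ} (hb : 1 ≤ b) (hc : 1 ≤ c) (hn : a + b + c = n) :
    ((Finset.range (2 * n)).image (pat3 n a b)).card = n - 1 := by
  rw [image_pat3 hb hc hn, Finset.card_erase_of_mem (Finset.mem_range.2 (by omega)),
    Finset.card_range]

lemma card_image_pat4 {n a c : ℕ} (ha : 1 ≤ a) (hc : 1 ≤ c) (hn : a + c = n) :
    ((Finset.range (2 * n)).image (pat4 n a)).card = n - 1 := by
  rw [image_pat4 ha hc hn, Finset.card_erase_of_mem (Finset.mem_range.2 (by omega)),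
    Finset.card_range]

lemma fiber_pat3 {n a b c : ℕ} (ha : 1 ≤ a) (hb : 1 ≤ b) (hc : 1 ≤ c) (hn : a + b + c = n) (t : ℕ)
    (ht : t < 2 * n) : pat3 n a b t = pat3 n a b 0 ↔ t = 0 ∨ t = a + b ∨ t = n + a := by
  have h1 := pat3_spec hb hn hc t ht
  have h2 := pat3_spec hb hn hc 0 (by omega)
  omega

lemma fiber_pat4 {n a c : ℕ} (ha : 1 ≤ a) (hc : 1 ≤ c) (hn : a + c = n) (t : ℕ)
    (ht : t < 2 * n) : pat4 n a t = pat4 n a 0 ↔ t = 0 ∨ t = a ∨ t = n ∨ t = n + a := by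
  have h1 := pat4_spec hn hc t ht
  have h2 := pat4_spec hn hc 0 (by omega)
  omega

/-- admissible lengths of the theta graph -/
def idx3 (n : ℕ) : Finset (ℕ × ℕ) :=
  (Finset.range n ×ˢ Finset.range n).filter
    (fun q => 1 ≤ q.1 ∧ 1 ≤ q.2 ∧ q.1 + q.2 < n ∧ 3 ≤ q.1 + q.2 ∧ q.1 + 3 ≤ n ∧ q.2 + 3 ≤ n)

lemma mem_idx3 {n : ℕ} {q : ℕ × ℕ} : q ∈ idx3 n ↔
    (1 ≤ q.1 ∧ 1 ≤ q.2 ∧ q.1 + q.2 < n ∧ 3 ≤ q.1 + q.2 ∧ q.1 + 3 ≤ n ∧ q.2 + 3 ≤ n) := by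
  simp only [idx3, Finset.mem_filter, Finset.mem_product, Finset.mem_range]
  constructor
  · exact fun h => h.2
  · intro h; exact ⟨by omega, h⟩

lemma card_tri (n : ℕ) : 2 * ((Finset.range n ×ˢ Finset.range n).filter
    (fun q => 1 ≤ q.1 ∧ 1 ≤ q.2 ∧ q.1 + q.2 < n)).card = (n - 1) * (n - 2) := by
  induction n with
  | zero => simp
  | succ n ih =>
    have : (Finset.range (n + 1) ×ˢ Finset.range (n + 1)).filter
        (fun q => 1 ≤ q.1 ∧ 1 ≤ q.2 ∧ q.1 + q.2 < n + 1)
      = (Finset.range n ×ˢ Finset.range n).filter (fun q => 1 ≤ q.1 ∧ 1 ≤ q.2 ∧ q.1 + q.2 < n)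
        ∪ (Finset.Ico 1 n).image (fun a => (a, n - a)) := by
      ext ⟨a, b⟩
      simp only [Finset.mem_filter, Finset.mem_product, Finset.mem_range, Finset.mem_union,
        Finset.mem_image, Finset.mem_Ico, Prod.mk.injEq]
      constructor
      · intro h
        by_cases h1 : a + b < n
        · left; omega
        · right; exact ⟨a, by omega, rfl, by omega⟩
      · rintro (h | ⟨c, h1, h2, h3⟩) <;> omega
    rw [this, Finset.card_union_of_disjoint, mul_add, ih, Finset.card_image_of_injective,
      Nat.card_Ico]
    · rcases n with _ | _ | n
      · simp
      · simp
      · simp only [Nat.add_sub_cancel]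
        have : n + 1 + 1 + 1 - 2 = n + 1 := by omega
        rw [this]; simp; ring
    · intro a b h; simpa using (Prod.ext_iff.1 h).1
    · rw [Finset.disjoint_left]
      rintro ⟨a, b⟩ h1 h2
      simp only [Finset.mem_filter, Finset.mem_image, Finset.mem_Ico, Prod.mk.injEq] at h1 h2
      obtain ⟨c, h3, h4, h5⟩ := h2
      omega

lemma card_idx3 {n : ℕ} (hn : 5 ≤ n) : 2 * (idx3 n).card + 6 = (n - 1) * (n - 2) := by
  rw [← card_tri n]
  have : (Finset.range n ×ˢ Finset.range n).filter (fun q => 1 ≤ q.1 ∧ 1 ≤ q.2 ∧ q.1 + q.2 < n)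
      = idx3 n ∪ {(1, 1), (1, n - 2), (n - 2, 1)} := by
    ext ⟨a, b⟩
    simp only [mem_idx3, Finset.mem_filter, Finset.mem_product, Finset.mem_range,
      Finset.mem_union, Finset.mem_insert, Finset.mem_singleton, Prod.mk.injEq]
    omega
  rw [this, Finset.card_union_of_disjoint]
  · have h3 : ({(1, 1), (1, n - 2), (n - 2, 1)} : Finset (ℕ × ℕ)).card = 3 := by
      rw [Finset.card_eq_three]
      refine ⟨_, _, _, ?_, ?_, ?_, rfl⟩ <;> simp <;> omega
    rw [h3]; ring
  · rw [Finset.disjoint_left]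
    rintro ⟨a, b⟩ h1 h2
    simp only [mem_idx3, Finset.mem_insert, Finset.mem_singleton, Prod.mk.injEq] at h1 h2
    omega

open Classical in
/-- balanced walks with `n-1` vertices -/
noncomputable def XX (n N : ℕ) [NeZero (2 * n)] : Finset (ZMod (2 * n) → Fin N) :=
  Finset.univ.filter (fun x => UValid x ∧ (Finset.univ.image x).card + 1 = n)

lemma X3_eq {n N : ℕ} [NeZero (2 * n)] (hn : 5 ≤ n) :
    (XX n N).filter (fun x => fib x 0 = 3)
      = (idx3 n).biUnion (fun q => Kset (2 * n) N (pat3 n q.1 q.2)) := by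
  classical
  ext x
  simp only [XX, Finset.mem_filter, Finset.mem_univ, true_and, Finset.mem_biUnion]
  constructor
  · rintro ⟨⟨hv, hc⟩, hf⟩
    obtain ⟨a, b, c, ha, hb, hcc, hs, g1, g2, g3, e1, e2, e3, e4, r1, r2, r3⟩ :=
      struct_three hv rfl hc hf
    refine ⟨(a, b), mem_idx3.2 ⟨ha, hb, by simp only; omega, g1, by simp only; omega,
      by simp only; omega⟩, ?_⟩
    apply mem_K_of
    · intro t ht
      simp only
      rcases pat3_spec hb hs hcc t ht with ⟨_, _, h⟩ | ⟨h1, h⟩ | ⟨h1, h2, h⟩ | ⟨h1, h2, h⟩ | ⟨h1, h⟩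
      · rw [h]
      · rw [h, h1, e1]
      · exact (r1 _ _ (by omega) h).symm
      · exact (r2 _ _ (by omega) (by omega) h).symm
      · exact (r3 _ _ (by omega) (by omega) h).symm
    · rw [card_image_pat3 hb hcc hs]; omega
  · rintro ⟨⟨a, b⟩, hq, hx⟩
    rw [mem_idx3] at hq
    simp only at hq hx
    obtain ⟨c, hs⟩ : ∃ c, a + b + c = n := ⟨n - a - b, by omega⟩
    have hc : 1 ≤ c := by omega
    refine ⟨⟨valid_of_K (patOK3 hq.1 hq.2.1 hc hs (by omega) (by omega) (by omega)) hx, ?_⟩, ?_⟩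
    · rw [card_image_Kset hx, card_image_pat3 hq.2.1 hc hs]; omega
    · rw [fib_of_K hx]
      have : (Finset.range (2 * n)).filter (fun t => pat3 n a b t = pat3 n a b 0)
          = {0, a + b, n + a} := by
        ext t
        simp only [Finset.mem_filter, Finset.mem_range, Finset.mem_insert, Finset.mem_singleton]
        constructor
        · rintro ⟨h1, h2⟩
          exact (fiber_pat3 hq.1 hq.2.1 hc hs t h1).1 h2
        · intro h
          have h1 : t < 2 * n := by omega
          exact ⟨h1, (fiber_pat3 hq.1 hq.2.1 hc hs t h1).2 h⟩
      rw [this, Finset.card_eq_three]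
      exact ⟨_, _, _, by omega, by omega, by omega, rfl⟩

lemma X4_eq {n N : ℕ} [NeZero (2 * n)] (hn : 5 ≤ n) :
    (XX n N).filter (fun x => fib x 0 = 4)
      = (Finset.Ico 3 (n - 2)).biUnion (fun a => Kset (2 * n) N (pat4 n a)) := by
  classical
  ext x
  simp only [XX, Finset.mem_filter, Finset.mem_univ, true_and, Finset.mem_biUnion, Finset.mem_Ico]
  constructor
  · rintro ⟨⟨hv, hc⟩, hf⟩
    obtain ⟨a, c, ha, hcc, hs, e1, e2, e3, r1, r2⟩ := struct_four hv rfl hc hf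
    refine ⟨a, by omega, ?_⟩
    apply mem_K_of
    · intro t ht
      rcases pat4_spec hs (by omega) t ht with
        ⟨_, _, h⟩ | ⟨h1, h⟩ | ⟨h1, h⟩ | ⟨h1, h2, h⟩ | ⟨h1, h⟩
      · rw [h]
      · rw [h, h1, e1]
      · rw [h, h1, e2]
      · exact (r1 _ _ (by omega) h).symm
      · exact (r2 _ _ (by omega) (by omega) (by omega)).symm
    · rw [card_image_pat4 (by omega) (by omega) hs]; omega
  · rintro ⟨a, hq, hx⟩
    obtain ⟨c, hs⟩ : ∃ c, a + c = n := ⟨n - a, by omega⟩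
    refine ⟨⟨valid_of_K (patOK4 hq.1 (by omega) hs) hx, ?_⟩, ?_⟩
    · rw [card_image_Kset hx, card_image_pat4 (by omega) (by omega : 1 ≤ c) hs]; omega
    · rw [fib_of_K hx]
      have : (Finset.range (2 * n)).filter (fun t => pat4 n a t = pat4 n a 0)
          = {0, a, n, n + a} := by
        ext t
        simp only [Finset.mem_filter, Finset.mem_range, Finset.mem_insert, Finset.mem_singleton]
        constructor
        · rintro ⟨h1, h2⟩
          exact (fiber_pat4 (by omega) (by omega : 1 ≤ c) hs t h1).1 h2
        · intro h
          have h1 : t < 2 * n := by omega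
          exact ⟨h1, (fiber_pat4 (by omega) (by omega : 1 ≤ c) hs t h1).2 h⟩
      rw [this]
      rw [Finset.card_insert_of_notMem, Finset.card_eq_three.2 ⟨_, _, _, _, _, _, rfl⟩]
      all_goals first | omega | (simp; omega)

lemma K_ker {m : ℕ} [NeZero m] {N : ℕ} {p : ℕ → ℕ} {x : ZMod m → Fin N}
    (hx : x ∈ Kset m N p) {s t : ℕ} (hs : s < m) (ht : t < m) :
    x (s : ZMod m) = x (t : ZMod m) ↔ p s = p t := by
  simp only [Kset, Finset.mem_filter, Finset.mem_univ, true_and] at hx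
  rw [hx, ZMod.val_cast_of_lt hs, ZMod.val_cast_of_lt ht]

lemma card_X3 {n N : ℕ} [NeZero (2 * n)] (hn : 5 ≤ n) :
    ((XX n N).filter (fun x => fib x 0 = 3)).card = (idx3 n).card * N.descFactorial (n - 1) := by
  classical
  rw [X3_eq hn, Finset.card_biUnion, Finset.sum_const_nat]
  · rintro ⟨a, b⟩ hq
    rw [mem_idx3] at hq
    simp only at hq
    rw [card_Kset, card_image_pat3 hq.2.1 (c := n - a - b) (by omega) (by omega)]
  · rintro ⟨a, b⟩ hq ⟨a', b'⟩ hq' hne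
    rw [Finset.mem_coe, mem_idx3] at hq hq'
    simp only at hq hq'
    simp only [Function.onFun]
    rw [Finset.disjoint_left]
    intro x hx hx'
    apply hne
    have k1 := K_ker hx (s := a + b) (t := 0) (by omega) (by omega)
    have k1' := K_ker hx' (s := a + b) (t := 0) (by omega) (by omega)
    have k2 := K_ker hx (s := n + a) (t := 0) (by omega) (by omega)
    have k2' := K_ker hx' (s := n + a) (t := 0) (by omega) (by omega)
    rw [fiber_pat3 hq.1 hq.2.1 (c := n - a - b) (by omega) (by omega) _ (by omega)] at k1 k2
    rw [fiber_pat3 hq'.1 hq'.2.1 (c := n - a' - b') (by omega) (by omega) _ (by omega)] at k1' k2'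
    have j1 := k1'.1 (k1.2 (by simp))
    have j2 := k2'.1 (k2.2 (by simp))
    simp only [Prod.mk.injEq]
    omega

lemma card_X4 {n N : ℕ} [NeZero (2 * n)] (hn : 5 ≤ n) :
    ((XX n N).filter (fun x => fib x 0 = 4)).card = (n - 5) * N.descFactorial (n - 1) := by
  classical
  rw [X4_eq hn, Finset.card_biUnion, Finset.sum_const_nat (m := N.descFactorial (n - 1)),
    Nat.card_Ico]
  · congr 1
  · intro a hq
    rw [Finset.mem_Ico] at hq
    rw [card_Kset, card_image_pat4 (c := n - a) (by omega) (by omega) (by omega)]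
  · intro a hq a' hq' hne
    rw [Finset.mem_coe, Finset.mem_Ico] at hq hq'
    simp only [Function.onFun]
    rw [Finset.disjoint_left]
    intro x hx hx'
    apply hne
    have k1 := K_ker hx (s := a) (t := 0) (by omega) (by omega)
    have k1' := K_ker hx' (s := a) (t := 0) (by omega) (by omega)
    rw [fiber_pat4 (c := n - a) (by omega) (by omega) (by omega) _ (by omega)] at k1
    rw [fiber_pat4 (c := n - a') (by omega) (by omega) (by omega) _ (by omega)] at k1'
    have j1 := k1'.1 (k1.2 (by simp))
    omega



section comb6
variable {m : ℕ} [NeZero m] {V : Type*} [DecidableEq V]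

lemma fib_shift (x : ZMod m → V) (b i : ZMod m) : fib (fun j => x (j + b)) i = fib x (i + b) := by
  unfold fib
  apply Finset.card_bij (fun j _ => j + b)
  · intro j hj; simpa using hj
  · intro j _ k _ h; exact add_right_cancel h
  · intro j hj; exact ⟨j - b, by simpa using hj, by ring⟩

lemma UValid_shift {x : ZMod m → V} (h : UValid x) (b : ZMod m) : UValid (fun j => x (j + b)) := by
  obtain ⟨h1, h2, τ, hτ⟩ := h
  refine ⟨fun i => ?_, fun i => ?_, (Equiv.addRight b).trans (τ.trans (Equiv.addRight (-b))),
    fun i => ⟨?_, ?_⟩⟩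
  · have := h1 (i + b)
    rwa [show i + b + 1 = i + 1 + b by ring] at this
  · have := h2 (i + b)
    rwa [show i + b + 2 = i + 2 + b by ring] at this
  · simp [(hτ (i + b)).1]
  · have := (hτ (i + b)).2
    simp only [Equiv.trans_apply, Equiv.coe_addRight]
    rw [show τ (i + b) + -b - 1 + b = τ (i + b) - 1 by ring, this]
    congr 1; ring

lemma image_shift (x : ZMod m → V) (b : ZMod m) :
    Finset.univ.image (fun j => x (j + b)) = Finset.univ.image x := by
  ext y
  simp only [Finset.mem_image, Finset.mem_univ, true_and]
  constructor
  · rintro ⟨i, rfl⟩; exact ⟨_, rfl⟩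
  · rintro ⟨i, rfl⟩; exact ⟨i - b, by simp⟩

end comb6

lemma XX_shift {n N : ℕ} [NeZero (2 * n)] {x : ZMod (2 * n) → Fin N} (hx : x ∈ XX n N)
    (b : ZMod (2 * n)) : (fun j => x (j + b)) ∈ XX n N := by
  classical
  simp only [XX, Finset.mem_filter, Finset.mem_univ, true_and] at hx ⊢
  exact ⟨UValid_shift hx.1 b, by rw [image_shift]; exact hx.2⟩

lemma card_shift {n N : ℕ} [NeZero (2 * n)] (b : ZMod (2 * n)) (k : ℕ) :
    ((XX n N).filter (fun x => fib x b = k)).card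
      = ((XX n N).filter (fun x => fib x 0 = k)).card := by
  apply Finset.card_bij (fun x _ => fun j => x (j + b))
  · intro x hx
    rw [Finset.mem_filter] at hx ⊢
    refine ⟨XX_shift hx.1 b, ?_⟩
    rw [fib_shift, zero_add]; exact hx.2
  · intro x _ y _ h
    funext j
    have := congrFun h (j - b)
    simpa using this
  · intro x hx
    rw [Finset.mem_filter] at hx
    refine ⟨fun j => x (j + -b), ?_, ?_⟩
    · rw [Finset.mem_filter]
      refine ⟨XX_shift hx.1 _, ?_⟩
      rw [fib_shift]; simpa using hx.2
    · funext j
      show x (j + b + -b) = x j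
      rw [add_neg_cancel_right]

lemma sum_break {n N : ℕ} [NeZero (2 * n)] (k : ℕ) :
    ∑ x ∈ XX n N, (Finset.univ.filter (fun i => fib x i = k)).card
      = 2 * n * ((XX n N).filter (fun x => fib x 0 = k)).card := by
  simp_rw [Finset.card_filter]
  rw [Finset.sum_comm]
  simp_rw [← Finset.card_filter]
  rw [Finset.sum_congr rfl (fun b _ => card_shift b k), Finset.sum_const, Finset.card_univ,
    ZMod.card, smul_eq_mul]

lemma card_XX {n N : ℕ} [NeZero (2 * n)] (hn : 5 ≤ n) :
    6 * (XX n N).card + 19 * n * N.descFactorial (n - 1) = n ^ 3 * N.descFactorial (n - 1) := by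
  classical
  have h3 := sum_break (n := n) (N := N) 3
  have h4 := sum_break (n := n) (N := N) 4
  rw [card_X3 hn] at h3
  rw [card_X4 hn] at h4
  have hs : ∑ x ∈ XX n N, (2 * (Finset.univ.filter (fun i => fib x i = 3)).card
      + 3 * (Finset.univ.filter (fun i => fib x i = 4)).card) = 12 * (XX n N).card := by
    rw [Finset.sum_const_nat (m := 12)]
    · ring
    intro x hx
    simp only [XX, Finset.mem_filter, Finset.mem_univ, true_and] at hx
    have := break_counts hx.1 rfl hx.2
    omega
  rw [Finset.sum_add_distrib, ← Finset.mul_sum, ← Finset.mul_sum, h3, h4] at hs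
  have hi := card_idx3 hn
  set D := N.descFactorial (n - 1)
  set c := (idx3 n).card
  obtain ⟨k, rfl⟩ : ∃ k, n = k + 5 := ⟨n - 5, by omega⟩
  simp only [Nat.add_sub_cancel, show k + 5 - 1 = k + 4 by omega,
    show k + 5 - 2 = k + 3 by omega] at hs hi
  zify at hs hi ⊢
  apply mul_left_cancel₀ (two_ne_zero : (2 : ℤ) ≠ 0)
  linear_combination (-1) * hs + 2 * (k + 5) * D * hi

lemma card_le_of_image {m : ℕ} [NeZero m] {N k : ℕ} (S : Finset (ZMod m → Fin N))
    (hS : ∀ x ∈ S, (Finset.univ.image x).card ≤ k) : S.card ≤ k ^ m * N ^ k := by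
  classical
  rcases Nat.eq_zero_or_pos k with rfl | hk
  · have : S = ∅ := by
      rw [Finset.eq_empty_iff_forall_notMem]
      intro x hx
      have h1 := hS x hx
      have : x 0 ∈ Finset.univ.image x := Finset.mem_image_of_mem _ (Finset.mem_univ _)
      have := Finset.card_pos.2 ⟨_, this⟩
      omega
    rw [this]; simp
  have hsub : S ⊆ (Finset.univ : Finset ((ZMod m → Fin k) × (Fin k → Fin N))).image
      (fun q => q.2 ∘ q.1) := by
    intro x hx
    have h1 := hS x hx
    have hc : Fintype.card (Finset.univ.image x) ≤ Fintype.card (Fin k) := by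
      rw [Fintype.card_coe, Fintype.card_fin]; exact h1
    obtain ⟨e⟩ := Function.Embedding.nonempty_of_card_le hc
    have hne : Nonempty (Finset.univ.image x) :=
      ⟨⟨x 0, Finset.mem_image_of_mem _ (Finset.mem_univ _)⟩⟩
    rw [Finset.mem_image]
    refine ⟨(fun i => e ⟨x i, Finset.mem_image_of_mem _ (Finset.mem_univ _)⟩,
      fun r => (Function.invFun e r).1), Finset.mem_univ _, ?_⟩
    funext i
    simp only [Function.comp]
    rw [Function.leftInverse_invFun e.injective]
  calc S.card ≤ _ := Finset.card_le_card hsub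
    _ ≤ _ := Finset.card_image_le
    _ = k ^ m * N ^ k := by
      rw [Finset.card_univ, Fintype.card_prod, Fintype.card_fun, Fintype.card_fun, ZMod.card,
        Fintype.card_fin, Fintype.card_fin]

open Classical in
/-- all balanced cyclically nonbacktracking walks -/
noncomputable def allValid (n N : ℕ) [NeZero (2 * n)] : Finset (ZMod (2 * n) → Fin N) :=
  Finset.univ.filter (fun x => UValid x)

lemma card_all {n N : ℕ} [NeZero (2 * n)] (hn : 5 ≤ n) :
    (XX n N).card ≤ (allValid n N).card ∧
    (allValid n N).card ≤ (XX n N).card + (n - 2) ^ (2 * n) * N ^ (n - 2) := by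
  classical
  have hsub : XX n N ⊆ allValid n N := by
    intro x hx
    simp only [XX, allValid, Finset.mem_filter, Finset.mem_univ, true_and] at hx ⊢
    exact hx.1
  refine ⟨Finset.card_le_card hsub, ?_⟩
  rw [← Finset.card_sdiff_add_card_eq_card hsub, add_comm]
  apply Nat.add_le_add_left
  apply card_le_of_image
  intro x hx
  simp only [XX, allValid, Finset.mem_sdiff, Finset.mem_filter, Finset.mem_univ, true_and,
    not_and] at hx
  have h1 := card_image_lt hx.1 rfl
  have h2 := hx.2 hx.1
  omega



section partA
variable {L V : Type*} [Fintype L] [DecidableEq L] [Fintype V] [DecidableEq V]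

/-- scaled Chebyshev polynomials of the second kind in a matrix -/
noncomputable def chebA (q : ℂ) (M : Matrix V V ℂ) : ℕ → Matrix V V ℂ
  | 0 => 1
  | 1 => M
  | (k + 2) => chebA q M (k + 1) * M - q • chebA q M k

lemma chebA_T (q s : ℂ) (M W : Matrix V V ℂ) (hs : s ^ 2 = q) (hW : (2 * s) • W = M) (k : ℕ) :
    chebA q M (k + 2) - q • chebA q M k
      = (2 * s ^ (k + 2)) • Polynomial.aeval W (Polynomial.Chebyshev.T ℂ ((k + 2 : ℕ) : ℤ)) := by
  have hT : ∀ k : ℕ, Polynomial.aeval W (Polynomial.Chebyshev.T ℂ ((k + 2 : ℕ) : ℤ))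
      = (2 : ℂ) • (Polynomial.aeval W (Polynomial.Chebyshev.T ℂ ((k + 1 : ℕ) : ℤ)) * W)
        - Polynomial.aeval W (Polynomial.Chebyshev.T ℂ ((k : ℕ) : ℤ)) := by
    intro k
    have := Polynomial.Chebyshev.T_add_two ℂ (k : ℤ)
    push_cast
    rw [this, show (2 * Polynomial.X * Polynomial.Chebyshev.T ℂ ((k : ℤ) + 1)
      - Polynomial.Chebyshev.T ℂ (k : ℤ) : Polynomial ℂ)
      = (2 : ℂ) • (Polynomial.Chebyshev.T ℂ ((k : ℤ) + 1) * Polynomial.X)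
        - Polynomial.Chebyshev.T ℂ (k : ℤ) by
        rw [Polynomial.smul_eq_C_mul, Polynomial.C_ofNat]; ring]
    simp
  induction k using Nat.twoStepInduction with
  | zero =>
    rw [hT]
    simp only [chebA, ← hW, ← hs, Nat.cast_zero, Polynomial.Chebyshev.T_zero, zero_add,
      Nat.cast_one, Polynomial.Chebyshev.T_one, map_one, Polynomial.aeval_X]
    simp only [smul_mul_assoc, mul_smul_comm, smul_sub, smul_smul]
    match_scalars <;> ring
  | one =>
    rw [hT, hT]
    simp only [chebA, ← hW, ← hs, Nat.cast_zero, Polynomial.Chebyshev.T_zero, zero_add,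
      Nat.cast_one, Polynomial.Chebyshev.T_one, map_one, Polynomial.aeval_X]
    simp only [smul_mul_assoc, mul_smul_comm, smul_sub, smul_smul, sub_mul, one_mul]
    match_scalars <;> ring
  | more k h1 h2 =>
    rw [hT]
    have e : chebA q M (k + 2 + 2) - q • chebA q M (k + 2)
      = (chebA q M (k + 1 + 2) - q • chebA q M (k + 1)) * M
        - q • (chebA q M (k + 2) - q • chebA q M k) := by
      simp only [chebA, sub_mul, smul_mul_assoc, smul_sub]
      abel
    rw [e, h1, h2]
    conv_lhs => rw [← hW, ← hs]
    simp only [smul_mul_assoc, mul_smul_comm, smul_sub, smul_smul]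
    rw [show k + 1 + 2 = k + 2 + 1 by ring]
    congr 2 <;> ring

lemma trace_B_pow (q : ℂ) (P : Matrix L V ℂ) (Q : Matrix V L ℂ) (J Pi : Matrix L L ℂ)
    (M : Matrix V V ℂ) (hQP : Q * P = M) (hQJP : Q * J * P = (q + 1) • (1 : Matrix V V ℂ))
    (hJJ : J * J = Pi) (hQPi : Q * Pi = Q) (hPiP : Pi * P = P) (hPiJ : Pi * J = J) (n : ℕ) :
    trace ((P * Q - J) ^ (2 * n + 2)) = trace Pi - 2 * trace (1 : Matrix V V ℂ)
      + trace (chebA q M (2 * n + 2) - q • chebA q M (2 * n)) := by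
  set B := P * Q - J with hB
  have hQJJ : Q * J * J = Q := by rw [Matrix.mul_assoc, hJJ, hQPi]
  have hPiB : Pi * B = B := by
    rw [hB, Matrix.mul_sub, ← Matrix.mul_assoc, hPiP, hPiJ]
  have hQB : Q * B = M * Q - Q * J := by
    rw [hB, Matrix.mul_sub, ← Matrix.mul_assoc, hQP]
  have hQJB : Q * J * B = q • Q := by
    rw [hB, Matrix.mul_sub, ← Matrix.mul_assoc, hQJP, hQJJ, Matrix.smul_mul, Matrix.one_mul,
      add_smul, one_smul, add_sub_cancel_right]
  have hk : ∀ k, Q * B ^ (k + 1) = chebA q M (k + 1) * Q - chebA q M k * (Q * J) := by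
    intro k
    induction k with
    | zero => simp [chebA, hQB]
    | succ k ih =>
      rw [pow_succ, ← Matrix.mul_assoc, ih, Matrix.sub_mul, Matrix.mul_assoc, hQB,
        Matrix.mul_assoc, hQJB, Matrix.mul_sub, ← Matrix.mul_assoc]
      simp only [chebA, Matrix.sub_mul, Matrix.mul_smul, Matrix.smul_mul]
      abel
  have hB2 : B ^ 2 = Pi + P * (Q * B) - J * P * Q := by
    rw [pow_two, hQB, ← hJJ, hB]
    simp only [Matrix.sub_mul, Matrix.mul_sub, Matrix.mul_assoc, ← hQP]
    abel
  have hkP : ∀ k, Q * B ^ (k + 1) * P = chebA q M (k + 1) * M - (q + 1) • chebA q M k := by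
    intro k
    rw [hk, Matrix.sub_mul, Matrix.mul_assoc, hQP, Matrix.mul_assoc, hQJP, Matrix.mul_smul,
      Matrix.mul_one]
  have hkJP : ∀ k, Q * B ^ (k + 1) * (J * P)
      = (q + 1) • chebA q M (k + 1) - chebA q M k * M := by
    intro k
    rw [hk, Matrix.sub_mul, Matrix.mul_assoc, ← Matrix.mul_assoc Q, hQJP, Matrix.mul_assoc,
      ← Matrix.mul_assoc (Q * J), hQJJ, hQP, Matrix.mul_smul, Matrix.mul_one]
  induction n with
  | zero =>
    have h1 := hkP 0
    rw [zero_add, pow_one] at h1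
    rw [mul_zero, zero_add, hB2, trace_sub, trace_add, trace_mul_comm P, h1, trace_mul_comm _ Q,
      ← Matrix.mul_assoc, hQJP]
    simp only [chebA, trace_sub, trace_smul, smul_eq_mul]
    ring
  | succ n ih =>
    have e : B ^ (2 * (n + 1) + 2) = B ^ (2 * n + 2) + P * (Q * B ^ (2 * n + 2 + 1))
        - J * P * (Q * B ^ (2 * n + 1 + 1)) := by
      rw [show 2 * (n + 1) + 2 = 2 + (2 * n + 2) by ring, pow_add, hB2, sub_mul, add_mul]
      congr 1
      · congr 1
        · rw [pow_succ' B (2 * n + 1), ← mul_assoc, hPiB]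
        · rw [pow_succ' B (2 * n + 2)]
          simp only [Matrix.mul_assoc]
      · rw [Matrix.mul_assoc]
    rw [e, trace_sub, trace_add, ih, trace_mul_comm P, hkP, trace_mul_comm (J * P), hkJP]
    rw [show 2 * (n + 1) = 2 * n + 2 by ring]
    simp only [chebA, trace_sub, trace_smul, smul_eq_mul, Matrix.sub_mul]
    ring

end partA



section partB
variable {V : Type*} [Fintype V] [DecidableEq V]

/-- the nonbacktracking edge matrix -/
def edgeB (M : Matrix V V ℂ) : Matrix (V × V) (V × V) ℂ :=
  fun e f => if e.2 = f.1 ∧ f.1 ≠ f.2 ∧ f.2 ≠ e.1 then M e.1 e.2 else 0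

lemma trace_edgeB (M : Matrix V V ℂ) (h0 : ∀ u, M u u = 0)
    (h1 : ∀ u v, u ≠ v → M u v * M v u = 1) (n : ℕ) :
    trace (edgeB M ^ (2 * n + 2)) = (Fintype.card V : ℂ) * (Fintype.card V - 1)
      - 2 * Fintype.card V
      + trace (chebA ((Fintype.card V : ℂ) - 2) M (2 * n + 2)
        - ((Fintype.card V : ℂ) - 2) • chebA ((Fintype.card V : ℂ) - 2) M (2 * n)) := by
  let P : Matrix (V × V) V ℂ := fun e w => if e.2 = w then M e.1 e.2 else 0
  let Q : Matrix V (V × V) ℂ := fun w e => if e.1 = w ∧ e.1 ≠ e.2 then 1 else 0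
  let J : Matrix (V × V) (V × V) ℂ := fun e f => if f = e.swap then M e.1 e.2 else 0
  let Pi : Matrix (V × V) (V × V) ℂ := Matrix.diagonal (fun e => if e.1 ≠ e.2 then 1 else 0)
  have hQP : Q * P = M := by
    ext u v
    rw [Matrix.mul_apply]
    simp only [Q, P, Fintype.sum_prod_type]
    rw [Finset.sum_eq_single u, Finset.sum_eq_single v]
    · by_cases h : u = v <;> simp [h, h0]
    · intro b _ hb; simp [hb]
    · simp
    · intro b _ hb; simp [hb]
    · simp
  have hJmul : ∀ (A : Matrix V (V × V) ℂ) w e, (A * J) w e = A w e.swap * M e.2 e.1 := by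
    intro A w e
    rw [Matrix.mul_apply]
    simp only [J]
    rw [Finset.sum_eq_single e.swap]
    · simp
    · intro b _ hb
      rw [if_neg, mul_zero]
      rintro rfl; simp at hb
    · simp
  have hQJP : Q * J * P = ((Fintype.card V : ℂ) - 2 + 1) • (1 : Matrix V V ℂ) := by
    ext u v
    rw [Matrix.mul_apply]
    simp only [hJmul]
    simp only [Q, P, Fintype.sum_prod_type_right, Prod.fst_swap, Prod.snd_swap]
    rw [Finset.sum_eq_single u]
    · by_cases h : u = v
      · subst h
        have : ∀ x, (if u = u ∧ u ≠ x then (1 : ℂ) else 0) * M u x * (if u = u then M x u else 0)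
            = if x = u then 0 else 1 := by
          intro x
          by_cases hx : x = u
          · simp [hx]
          · have hx' : u ≠ x := fun h => hx h.symm
            simp [hx, hx', h1 u x hx']
        rw [Finset.sum_congr rfl (fun x _ => this x)]
        rw [Finset.sum_ite, Finset.sum_const_zero, zero_add, Finset.sum_const, nsmul_eq_mul,
          Finset.filter_ne', Finset.card_erase_of_mem (Finset.mem_univ _), Finset.card_univ,
          Nat.cast_sub (Fintype.card_pos_iff.2 ⟨u⟩)]
        simp
        ring
      · simp [h]
    · intro b _ hb; simp [hb]
    · simp
  have hJJ : J * J = Pi := by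
    ext e f
    rw [Matrix.mul_apply]
    simp only [J, Pi, Matrix.diagonal_apply]
    rw [Finset.sum_eq_single e.swap]
    · by_cases h : e = f
      · subst h
        by_cases h' : e.1 = e.2
        · simp [h', h0]
        · simp [h', h1 _ _ h']
      · have : f ≠ e := fun h' => h h'.symm
        simp [h, this]
    · intro b _ hb; simp [hb]
    · simp
  have hQPi : Q * Pi = Q := by
    ext w e
    rw [Matrix.mul_diagonal]
    simp only [Q]
    by_cases h : e.1 = e.2 <;> simp [h]
  have hPiP : Pi * P = P := by
    ext e w
    rw [Matrix.diagonal_mul]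
    simp only [P]
    by_cases h : e.1 = e.2 <;> simp [h, h0]
  have hPiJ : Pi * J = J := by
    ext e w
    rw [Matrix.diagonal_mul]
    simp only [J]
    by_cases h : e.1 = e.2 <;> simp [h, h0]
  have hB : edgeB M = P * Q - J := by
    ext e f
    obtain ⟨a, b⟩ := e
    obtain ⟨c, d⟩ := f
    rw [Matrix.sub_apply, Matrix.mul_apply]
    simp only [P, Q, J, edgeB, Prod.swap_prod_mk, Prod.mk.injEq]
    rw [Finset.sum_eq_single b]
    · by_cases hbc : b = c
      · subst hbc
        by_cases hda : d = a
        · subst hda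
          by_cases hbd : b = d
          · subst hbd; simp [h0]
          · simp [hbd]
        · simp [hda]
      · have : ¬ c = b := fun h => hbc h.symm
        simp [hbc, this]
    · intro x _ hx
      rw [if_neg (fun h => hx h.symm), zero_mul]
    · simp
  have htr : trace Pi = (Fintype.card V : ℂ) * (Fintype.card V - 1) := by
    simp only [Pi, Matrix.trace_diagonal, Fintype.sum_prod_type]
    have : ∀ x : V, ∑ y : V, (if x ≠ y then (1 : ℂ) else 0) = Fintype.card V - 1 := by
      intro x
      rw [Finset.sum_ite, Finset.sum_const_zero, add_zero, Finset.sum_const, nsmul_eq_mul,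
        Finset.filter_ne, Finset.card_erase_of_mem (Finset.mem_univ _), Finset.card_univ,
          Nat.cast_sub (Fintype.card_pos_iff.2 ⟨x⟩)]
      simp
    simp only [this, Finset.sum_const, Finset.card_univ, nsmul_eq_mul]
  rw [hB, trace_B_pow _ P Q J Pi M hQP hQJP hJJ hQPi hPiP hPiJ, htr, Matrix.trace_one]

/-- powers of a matrix as sums over paths -/
lemma pow_apply_paths {ι : Type*} [Fintype ι] [DecidableEq ι] (A : Matrix ι ι ℂ) (k : ℕ)
    (a b : ι) : (A ^ (k + 1)) a b
      = ∑ y : Fin k → ι, ∏ j : Fin (k + 1),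
          A ((Fin.cons a y : Fin (k + 1) → ι) j) ((Fin.snoc y b : Fin (k + 1) → ι) j) := by
  induction k generalizing a with
  | zero => simp [Fin.snoc]
  | succ k ih =>
    rw [pow_succ', Matrix.mul_apply, ← (Fin.consEquiv (fun _ => ι)).sum_comp,
      Fintype.sum_prod_type]
    refine Finset.sum_congr rfl (fun c _ => ?_)
    rw [ih, Finset.mul_sum]
    refine Finset.sum_congr rfl (fun y _ => ?_)
    rw [Fin.prod_univ_succ (n := k + 1)]
    simp only [Fin.consEquiv, Equiv.coe_fn_mk, Fin.cons_zero, Fin.cons_succ,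
      ← Fin.cons_snoc_eq_snoc_cons]

lemma trace_pow_cyc {ι : Type*} [Fintype ι] [DecidableEq ι] (A : Matrix ι ι ℂ) (m : ℕ)
    [NeZero m] : trace (A ^ m) = ∑ z : ZMod m → ι, ∏ i, A (z i) (z (i + 1)) := by
  obtain ⟨k, rfl⟩ : ∃ k, m = k + 1 := ⟨m - 1, by have := NeZero.ne m; omega⟩
  show _ = ∑ z : Fin (k + 1) → ι, ∏ i : Fin (k + 1), A (z i) (z (i + 1))
  rw [← (Fin.consEquiv (fun _ => ι)).sum_comp, Fintype.sum_prod_type, Matrix.trace]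
  refine Finset.sum_congr rfl (fun a _ => ?_)
  rw [Matrix.diag_apply, pow_apply_paths]
  refine Finset.sum_congr rfl (fun y _ => ?_)
  refine Finset.prod_congr rfl (fun i _ => ?_)
  simp only [Fin.consEquiv, Equiv.coe_fn_mk]
  congr 1
  induction i using Fin.lastCases with
  | last => simp
  | cast i => simp [Fin.coeSucc_eq_succ]

end partB



/-- cyclically nonbacktracking -/
def NB {m : ℕ} {V : Type*} (x : ZMod m → V) : Prop :=
  (∀ i, x i ≠ x (i + 1)) ∧ (∀ i, x i ≠ x (i + 2))

open Classical in
lemma trace_edgeB_cyc {V : Type*} [Fintype V] [DecidableEq V] (M : Matrix V V ℂ) (m : ℕ)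
    [NeZero m] : trace (edgeB M ^ m)
      = ∑ x ∈ (Finset.univ : Finset (ZMod m → V)).filter NB, ∏ i, M (x i) (x (i + 1)) := by
  rw [trace_pow_cyc, Finset.sum_filter]
  symm
  apply Fintype.sum_of_injective (fun (x : ZMod m → V) i => (x i, x (i + 1)))
  · intro x y h
    funext i
    exact congrArg Prod.fst (congrFun h i)
  · intro z hz
    by_contra hne
    apply hz
    rw [← ne_eq, Finset.prod_ne_zero_iff] at hne
    refine ⟨fun i => (z i).1, ?_⟩
    funext i
    have h := hne i (Finset.mem_univ _)
    simp only [edgeB, ne_eq, ite_eq_right_iff, Classical.not_imp] at h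
    exact Prod.ext rfl h.1.1.symm
  · intro x
    split_ifs with h
    · refine Finset.prod_congr rfl (fun i _ => ?_)
      simp only [edgeB]
      rw [if_pos]
      refine ⟨trivial, h.1 _, ?_⟩
      have := h.2 i
      rw [show i + 1 + 1 = i + 2 by ring]
      exact this.symm
    · symm
      by_contra hne
      apply h
      rw [← ne_eq, Finset.prod_ne_zero_iff] at hne
      have h' : ∀ i, x (i + 1) ≠ x (i + 1 + 1) ∧ x (i + 1 + 1) ≠ x i := by
        intro i
        have h := hne i (Finset.mem_univ _)
        simp only [edgeB, ne_eq, ite_eq_right_iff, Classical.not_imp] at h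
        exact h.1.2
      refine ⟨fun i => ?_, fun i => ?_⟩
      · have := (h' (i - 1)).1
        simpa using this
      · have := (h' i).2
        rw [show i + 1 + 1 = i + 2 by ring] at this
        exact this.symm

/-- signed incidence of an oriented edge -/
def dd {N : ℕ} (a b u v : Fin N) : ℤ :=
  if u < v then (if a = u ∧ b = v then 1 else 0) - (if a = v ∧ b = u then 1 else 0) else 0

lemma dd_anti {N : ℕ} (a b u v : Fin N) : dd b a u v = - dd a b u v := by
  unfold dd
  grind

lemma phases_eq {N : ℕ} (ω : Fin N → Fin N → ℝ) (a b : Fin N) :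
    phases N ω a b = ∑ u, ∑ v, (dd a b u v : ℝ) * ω u v := by
  have hlt : ∀ a b : Fin N, a < b → ω a b = ∑ u, ∑ v, (dd a b u v : ℝ) * ω u v := by
    intro a b h
    rw [Finset.sum_eq_single a, Finset.sum_eq_single b]
    · have h2 : a ≠ b := h.ne
      simp [dd, h, h2]
    · intro v _ hv
      unfold dd
      split_ifs <;> simp_all
    · simp
    · intro u _ hu
      apply Finset.sum_eq_zero
      intro v _
      unfold dd
      split_ifs with h1 h2 h3 h4
      · exact absurd h2.1.symm hu
      · exact absurd h2.1.symm hu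
      · obtain ⟨rfl, rfl⟩ := h4
        exact absurd h (not_lt.2 h1.le)
      · simp
      · simp
    · simp
  unfold phases
  split_ifs with h1 h2
  · exact hlt a b h1
  · rw [hlt b a h2, ← Finset.sum_neg_distrib]
    refine Finset.sum_congr rfl (fun u _ => ?_)
    rw [← Finset.sum_neg_distrib]
    refine Finset.sum_congr rfl (fun v _ => ?_)
    rw [dd_anti a b]; push_cast; ring
  · have : a = b := le_antisymm (not_lt.1 h2) (not_lt.1 h1)
    subst this
    symm
    apply Finset.sum_eq_zero
    intro u _
    apply Finset.sum_eq_zero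
    intro v _
    have := dd_anti a a u v
    have : dd a a u v = 0 := by omega
    simp [this]

/-- net signed edge count of a walk -/
def netC {m N : ℕ} [NeZero m] (x : ZMod m → Fin N) (u v : Fin N) : ℤ :=
  ∑ i, dd (x i) (x (i + 1)) u v

lemma prod_ume {m N : ℕ} [NeZero m] (x : ZMod m → Fin N) (hx : ∀ i, x i ≠ x (i + 1))
    (ω : Fin N → Fin N → ℝ) :
    ∏ i, umeMatrix N (phases N ω) (x i) (x (i + 1))
      = ∏ u, ∏ v, Complex.exp (Complex.I * (netC x u v : ℂ) * (ω u v : ℂ)) := by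
  have h1 : ∀ i, umeMatrix N (phases N ω) (x i) (x (i + 1))
      = ∏ u, ∏ v, Complex.exp (Complex.I * (dd (x i) (x (i + 1)) u v : ℂ) * (ω u v : ℂ)) := by
    intro i
    unfold umeMatrix
    rw [if_neg (hx i), phases_eq]
    push_cast
    simp only [← Complex.exp_sum, Finset.mul_sum, mul_assoc]
  simp only [h1]
  rw [Finset.prod_comm]
  refine Finset.prod_congr rfl (fun u _ => ?_)
  rw [Finset.prod_comm]
  refine Finset.prod_congr rfl (fun v _ => ?_)
  rw [← Complex.exp_sum]
  congr 1
  unfold netC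
  push_cast
  rw [Finset.mul_sum, Finset.sum_mul]

instance uniformPhase_prob : IsProbabilityMeasure uniformPhase := by
  constructor
  unfold uniformPhase
  have h : ENNReal.ofReal (2 * Real.pi) ≠ 0 := by
    simp [Real.pi_pos]
  simp only [Measure.smul_apply, Measure.restrict_apply MeasurableSet.univ, Set.univ_inter,
    Real.volume_Ico, sub_zero, smul_eq_mul]
  exact ENNReal.inv_mul_cancel h ENNReal.ofReal_ne_top

lemma integral_phase (c : ℤ) :
    ∫ t, Complex.exp (Complex.I * (c : ℂ) * (t : ℂ)) ∂uniformPhase = if c = 0 then 1 else 0 := by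
  split_ifs with hc
  · subst hc
    simp
  · unfold uniformPhase
    rw [integral_smul_measure, integral_Ico_eq_integral_Ioc,
      ← intervalIntegral.integral_of_le (by positivity)]
    have hne : Complex.I * (c : ℂ) ≠ 0 := by simp [hc]
    rw [integral_exp_mul_complex hne]
    have : Complex.exp (Complex.I * (c : ℂ) * ((2 * Real.pi : ℝ) : ℂ)) = 1 := by
      rw [Complex.exp_eq_one_iff]
      exact ⟨c, by push_cast; ring⟩
    rw [this]
    simp

instance phaseMeasure_prob (N : ℕ) : IsProbabilityMeasure (phaseMeasure N) := by
  unfold phaseMeasure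
  infer_instance

lemma integral_prod_ume {m N : ℕ} [NeZero m] (x : ZMod m → Fin N) (hx : ∀ i, x i ≠ x (i + 1)) :
    ∫ ω, ∏ i, umeMatrix N (phases N ω) (x i) (x (i + 1)) ∂(phaseMeasure N)
      = ∏ u, ∏ v, if netC x u v = 0 then (1 : ℂ) else 0 := by
  simp only [prod_ume x hx]
  unfold phaseMeasure
  rw [integral_fintype_prod_eq_prod (𝕜 := ℂ) (E := fun _ : Fin N => Fin N → ℝ)
    (fun u y => ∏ v, Complex.exp (Complex.I * (netC x u v : ℂ) * (y v : ℂ)))]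
  refine Finset.prod_congr rfl (fun u _ => ?_)
  rw [integral_fintype_prod_eq_prod (𝕜 := ℂ) (E := fun _ : Fin N => ℝ)
    (fun v t => Complex.exp (Complex.I * (netC x u v : ℂ) * (t : ℂ)))]
  exact Finset.prod_congr rfl (fun v _ => integral_phase _)

lemma integrable_prod_ume {m N : ℕ} [NeZero m] (x : ZMod m → Fin N)
    (hx : ∀ i, x i ≠ x (i + 1)) :
    Integrable (fun ω => ∏ i, umeMatrix N (phases N ω) (x i) (x (i + 1))) (phaseMeasure N) := by
  simp only [prod_ume x hx]
  apply Integrable.of_bound (C := 1)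
  · apply Continuous.aestronglyMeasurable
    fun_prop
  · filter_upwards with ω
    rw [norm_prod]
    apply Finset.prod_le_one (fun _ _ => norm_nonneg _)
    intro u _
    rw [norm_prod]
    apply Finset.prod_le_one (fun _ _ => norm_nonneg _)
    intro v _
    rw [show Complex.I * (netC x u v : ℂ) * (ω u v : ℂ)
      = (((netC x u v : ℝ) * ω u v : ℝ) : ℂ) * Complex.I by push_cast; ring,
      Complex.norm_exp_ofReal_mul_I]

lemma UValid_iff {m N : ℕ} [NeZero m] (x : ZMod m → Fin N) :
    UValid x ↔ NB x ∧ ∀ u v, netC x u v = 0 := by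
  classical
  constructor
  · rintro ⟨h1, h2, τ, hτ⟩
    refine ⟨⟨h1, h2⟩, fun u v => ?_⟩
    have : netC x u v = - netC x u v := by
      conv_lhs => unfold netC
      rw [← (τ.trans (Equiv.addRight (-1))).sum_comp]
      unfold netC
      rw [← Finset.sum_neg_distrib]
      refine Finset.sum_congr rfl (fun i _ => ?_)
      simp only [Equiv.trans_apply, Equiv.coe_addRight]
      rw [show τ i + -1 + 1 = τ i by ring, ← sub_eq_add_neg, (hτ i).1, (hτ i).2, dd_anti]
    omega
  · rintro ⟨⟨h1, h2⟩, h⟩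
    refine ⟨h1, h2, ?_⟩
    let f : ZMod m → Fin N × Fin N := fun i => (x i, x (i + 1))
    let g : ZMod m → Fin N × Fin N := fun i => (x (i + 1), x i)
    have hlt : ∀ u v : Fin N, u < v → (Finset.univ.filter (fun i => f i = (u, v))).card
        = (Finset.univ.filter (fun i => g i = (u, v))).card := by
      intro u v huv
      have := h u v
      unfold netC dd at this
      simp only [if_pos huv] at this
      rw [Finset.sum_sub_distrib, sub_eq_zero, ← Finset.natCast_card_filter,
        ← Finset.natCast_card_filter] at this
      have h3 := Int.ofNat.inj this
      simp only [f, g, Prod.mk.injEq]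
      rw [h3]
      congr 1
      ext i
      simp [and_comm]
    have hfg : ∀ u v, Finset.univ.filter (fun i => f i = (u, v))
        = Finset.univ.filter (fun i => g i = (v, u)) := by
      intro u v
      ext i
      simp [f, g, and_comm]
    have hcard : ∀ c : Fin N × Fin N, Fintype.card {a // f a = c} = Fintype.card {a // g a = c} := by
      rintro ⟨u, v⟩
      rw [Fintype.card_subtype, Fintype.card_subtype]
      rcases lt_trichotomy u v with huv | rfl | huv
      · exact hlt u v huv
      · rw [hfg]
      · rw [hfg, ← hlt v u huv, hfg]
    let σ : ZMod m ≃ ZMod m := Equiv.ofFiberEquiv (f := f) (g := g)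
      (fun c => Fintype.equivOfCardEq (hcard c))
    have hσ : ∀ i, g (σ i) = f i := fun i => Equiv.ofFiberEquiv_map _ i
    refine ⟨σ.trans (Equiv.addRight 1), fun i => ?_⟩
    have := hσ i
    simp only [f, g, Prod.mk.injEq] at this
    simp only [Equiv.trans_apply, Equiv.coe_addRight, add_sub_cancel_right]
    exact this

lemma integral_trace {n N : ℕ} [NeZero (2 * n)] :
    Integrable (fun ω => trace (edgeB (umeMatrix N (phases N ω)) ^ (2 * n))) (phaseMeasure N) ∧
    ∫ ω, trace (edgeB (umeMatrix N (phases N ω)) ^ (2 * n)) ∂(phaseMeasure N)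
      = ((allValid n N).card : ℂ) := by
  classical
  simp only [trace_edgeB_cyc]
  constructor
  · apply integrable_finsetSum
    intro x hx
    exact integrable_prod_ume x (Finset.mem_filter.1 hx).2.1
  rw [integral_finsetSum]
  · rw [Finset.sum_congr rfl (fun x hx => integral_prod_ume x (Finset.mem_filter.1 hx).2.1)]
    have : ∀ x : ZMod (2 * n) → Fin N, (∏ u, ∏ v, if netC x u v = 0 then (1 : ℂ) else 0)
        = if ∀ u v, netC x u v = 0 then 1 else 0 := by
      intro x
      split_ifs with h
      · simp [h]
      · push Not at h
        obtain ⟨u, v, huv⟩ := h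
        exact Finset.prod_eq_zero (Finset.mem_univ u)
          (Finset.prod_eq_zero (Finset.mem_univ v) (if_neg huv))
    simp only [this]
    rw [← Finset.natCast_card_filter, Finset.filter_filter]
    congr 2
    ext x
    simp only [allValid, Finset.mem_filter, UValid_iff]
  · intro x hx
    exact integrable_prod_ume x (Finset.mem_filter.1 hx).2.1

lemma chebTrace_eq {N : ℕ} (hN : 3 ≤ N) (n : ℕ) (ω : Fin N → Fin N → ℝ) :
    chebTrace N (phases N ω) (2 * (n + 1))
      = (trace (edgeB (umeMatrix N (phases N ω)) ^ (2 * (n + 1))) - (N : ℂ) * (N - 3))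
        * (2 * ((N : ℂ) - 2) ^ (n + 1))⁻¹ := by
  set M := umeMatrix N (phases N ω) with hM
  have h0 : ∀ u, M u u = 0 := by intro u; simp [hM, umeMatrix]
  have h1 : ∀ u v, u ≠ v → M u v * M v u = 1 := by
    intro u v huv
    simp only [hM, umeMatrix, if_neg huv, if_neg huv.symm]
    rw [← Complex.exp_add, phases_eq, phases_eq]
    rw [← Complex.exp_zero]
    congr 1
    rw [← mul_add, ← Complex.ofReal_add]
    have : (∑ a, ∑ b, (dd u v a b : ℝ) * ω a b) + ∑ a, ∑ b, (dd v u a b : ℝ) * ω a b = 0 := by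
      rw [← Finset.sum_add_distrib]
      apply Finset.sum_eq_zero
      intro a _
      rw [← Finset.sum_add_distrib]
      apply Finset.sum_eq_zero
      intro b _
      rw [dd_anti u v]; push_cast; ring
    rw [this]; simp
  have hN' : (3 : ℝ) ≤ N := by exact_mod_cast hN
  have hsq : Real.sqrt ((N : ℝ) - 2) ^ 2 = (N : ℝ) - 2 := Real.sq_sqrt (by linarith)
  have hs0 : Real.sqrt ((N : ℝ) - 2) ≠ 0 := (Real.sqrt_pos.2 (by linarith)).ne'
  have hs0c : ((Real.sqrt ((N : ℝ) - 2) : ℝ) : ℂ) ≠ 0 := by exact_mod_cast hs0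
  have hsqc : ((Real.sqrt ((N : ℝ) - 2) : ℝ) : ℂ) ^ 2 = (N : ℂ) - 2 := by
    rw [← Complex.ofReal_pow, hsq]; push_cast; ring
  have hq0 : (N : ℂ) - 2 ≠ 0 := by rw [← hsqc]; exact pow_ne_zero _ hs0c
  have hW : (2 * ((Real.sqrt ((N : ℝ) - 2) : ℝ) : ℂ)) • scaledUme N (phases N ω) = M := by
    unfold scaledUme
    rw [smul_smul, ← hM]
    push_cast
    rw [mul_one_div_cancel (mul_ne_zero two_ne_zero hs0c), one_smul]
  have hA := chebA_T ((N : ℂ) - 2) _ M _ hsqc hW (2 * n)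
  have hB := trace_edgeB M h0 h1 n
  rw [Fintype.card_fin, hA, trace_smul, smul_eq_mul] at hB
  unfold chebTrace
  rw [show 2 * (n + 1) = 2 * n + 2 by ring, hB]
  have e : ((Real.sqrt ((N : ℝ) - 2) : ℝ) : ℂ) ^ (2 * n + 2) = ((N : ℂ) - 2) ^ (n + 1) := by
    rw [← hsqc, ← pow_mul]; congr 1
  rw [e, eq_mul_inv_iff_mul_eq₀ (mul_ne_zero two_ne_zero (pow_ne_zero _ hq0))]
  ring

lemma integral_chebTrace {n N : ℕ} [NeZero (2 * n)] (hN : 3 ≤ N) :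
    ∫ ω, chebTrace N (phases N ω) (2 * n) ∂(phaseMeasure N)
      = (((allValid n N).card : ℂ) - (N : ℂ) * (N - 3)) * (2 * ((N : ℂ) - 2) ^ n)⁻¹ := by
  have hi := integral_trace (n := n) (N := N)
  have hn : n ≠ 0 := by
    have := NeZero.ne (2 * n)
    omega
  obtain ⟨k, rfl⟩ := Nat.exists_eq_succ_of_ne_zero hn
  have h := fun ω => chebTrace_eq hN k ω
  simp only [Nat.succ_eq_add_one] at hi ⊢
  simp only [h]
  rw [integral_mul_const, integral_sub hi.1 (integrable_const _), hi.2, integral_const]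
  simp



lemma asym_real (n : ℕ) (hn : 5 ≤ n) (y K D A C : ℝ) (hy4 : 4 ≤ y) (hyn : (n : ℝ) ≤ y)
    (hK : 0 ≤ K) (hC : 0 ≤ C) (hD1 : (y - n) ^ n ≤ D * y) (hD2 : D * y ≤ y ^ n)
    (hA1 : K * D ≤ A) (hA2 : A ≤ K * D + C * y ^ (n - 2)) :
    |(A - y * (y - 3)) * (2 * (y - 2) ^ n)⁻¹ - K / (2 * y)|
      ≤ (2 ^ n * (K * n ^ 2 + C + 1)) * (y ^ 2)⁻¹ := by
  have hy0 : 0 < y := by linarith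
  have hq0 : 0 < y - 2 := by linarith
  have hn2 : (2 : ℝ) ≤ n := by exact_mod_cast (by omega : 2 ≤ n)
  have hpow : y ^ n = y ^ (n - 1) * y := by
    rw [← pow_succ]; congr 1; omega
  have hpow2 : y ^ (n - 1) = y ^ (n - 2) * y := by
    rw [← pow_succ]; congr 1; omega
  have hbern : y ^ n - (y - n) ^ n ≤ n ^ 2 * y ^ (n - 1) := by
    have h1 : (-2 : ℝ) ≤ -(n / y) := by
      have : (n : ℝ) / y ≤ 1 := by rw [div_le_one hy0]; exact hyn
      linarith
    have h2 := one_add_mul_le_pow h1 n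
    have h3 : (y - n) ^ n = y ^ n * (1 + -((n : ℝ) / y)) ^ n := by
      rw [← mul_pow]; congr 1; field_simp; ring
    have h4 := mul_le_mul_of_nonneg_left h2 (pow_nonneg hy0.le n)
    rw [← h3] at h4
    have h5 : y ^ n * (1 + (n : ℝ) * -((n : ℝ) / y)) = y ^ n - n ^ 2 * y ^ (n - 1) := by
      rw [hpow]; field_simp; ring
    rw [h5] at h4
    linarith
  have hq1 : (y - n) ^ n ≤ (y - 2) ^ n := pow_le_pow_left₀ (by linarith) (by linarith) n
  have hq2 : (y - 2) ^ n ≤ y ^ n := pow_le_pow_left₀ (by linarith) (by linarith) n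
  have hd : |D * y - (y - 2) ^ n| ≤ n ^ 2 * y ^ (n - 1) := by
    rw [abs_le]; constructor <;> linarith
  have hq3 : y ^ n ≤ 2 ^ n * (y - 2) ^ n := by
    rw [← mul_pow]; exact pow_le_pow_left₀ hy0.le (by linarith) n
  have hqn : 0 < (y - 2) ^ n := pow_pos hq0 n
  have hyp : 0 < y ^ (n - 1) := pow_pos hy0 _
  have hy3 : y ^ 3 ≤ y ^ (n - 1) := pow_le_pow_right₀ (by linarith) (by omega)
  have heq : (A - y * (y - 3)) * (2 * (y - 2) ^ n)⁻¹ - K / (2 * y)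
      = (K * (D * y - (y - 2) ^ n) + (A - K * D) * y - y ^ 2 * (y - 3))
        / (2 * y * (y - 2) ^ n) := by
    field_simp
    ring
  have hnum : |K * (D * y - (y - 2) ^ n) + (A - K * D) * y - y ^ 2 * (y - 3)|
      ≤ (K * n ^ 2 + C + 1) * y ^ (n - 1) := by
    have e1 : |K * (D * y - (y - 2) ^ n)| ≤ K * (n ^ 2 * y ^ (n - 1)) := by
      rw [abs_mul, abs_of_nonneg hK]
      exact mul_le_mul_of_nonneg_left hd hK
    have e2 : 0 ≤ (A - K * D) * y := mul_nonneg (by linarith) hy0.le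
    have e3 : (A - K * D) * y ≤ C * y ^ (n - 1) := by
      rw [hpow2, ← mul_assoc]
      exact mul_le_mul_of_nonneg_right (by linarith) hy0.le
    have e4 : 0 ≤ y ^ 2 * (y - 3) := mul_nonneg (by positivity) (by linarith)
    have e5 : y ^ 2 * (y - 3) ≤ y ^ 3 := by nlinarith [sq_nonneg y]
    have e6 : 0 ≤ C * y ^ (n - 1) := mul_nonneg hC hyp.le
    rw [abs_le] at e1 ⊢
    constructor <;> nlinarith [e1.1, e1.2]
  rw [heq, abs_div, abs_of_pos (by positivity : 0 < 2 * y * (y - 2) ^ n), ← div_eq_mul_inv,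
    div_le_div_iff₀ (by positivity) (by positivity)]
  have hG : 0 ≤ K * (n : ℝ) ^ 2 + C + 1 := by positivity
  calc _ ≤ ((K * n ^ 2 + C + 1) * y ^ (n - 1)) * y ^ 2 :=
        mul_le_mul_of_nonneg_right hnum (by positivity)
    _ = (K * n ^ 2 + C + 1) * y * y ^ n := by rw [hpow]; ring
    _ ≤ (K * n ^ 2 + C + 1) * y * (2 ^ n * (y - 2) ^ n) :=
        mul_le_mul_of_nonneg_left hq3 (by positivity)
    _ ≤ 2 * ((K * n ^ 2 + C + 1) * y * (2 ^ n * (y - 2) ^ n)) := by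
        have : 0 ≤ (K * n ^ 2 + C + 1) * y * (2 ^ n * (y - 2) ^ n) := by positivity
        linarith
    _ = _ := by ring

/-- for fixed `n ≥ 5`, as `N → ∞`,
`⟨Tr[T_{2n}(W)]⟩ = (n/(12N))[(n+1)(n−1) − 18] + O(N^{−2})`. -/
theorem cheb_trace_even_expectation_asymptotics (n : ℕ) (hn : 5 ≤ n) :
    ∃ (c : ℝ) (N₀ : ℕ), ∀ N ≥ N₀,
      ‖(∫ ω, chebTrace N (phases N ω) (2 * n) ∂(phaseMeasure N))
          - (n : ℂ) / (12 * (N : ℂ)) * (((n : ℂ) + 1) * ((n : ℂ) - 1) - 18)‖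
        ≤ c * ((N : ℝ) ^ 2)⁻¹ := by
  have : NeZero (2 * n) := ⟨by omega⟩
  set K : ℝ := (n : ℝ) * ((n : ℝ) ^ 2 - 19) / 6 with hKdef
  set C : ℝ := ((n - 2 : ℕ) : ℝ) ^ (2 * n) with hCdef
  refine ⟨2 ^ n * (K * n ^ 2 + C + 1), n + 4, fun N hN => ?_⟩
  have hn5 : (5 : ℝ) ≤ n := by exact_mod_cast hn
  have hNn : ((n : ℝ) + 4) ≤ N := by exact_mod_cast hN
  have hK : 0 ≤ K := by
    rw [hKdef]
    have : (0 : ℝ) ≤ (n : ℝ) ^ 2 - 19 := by nlinarith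
    positivity
  have hX : ((XX n N).card : ℝ) = K * (N.descFactorial (n - 1) : ℝ) := by
    have h := card_XX (n := n) (N := N) hn
    have h' : 6 * ((XX n N).card : ℝ) + 19 * n * (N.descFactorial (n - 1) : ℝ)
        = (n : ℝ) ^ 3 * (N.descFactorial (n - 1) : ℝ) := by exact_mod_cast h
    rw [hKdef]
    linear_combination (1 / 6) * h'
  obtain ⟨ha1, ha2⟩ := card_all (n := n) (N := N) hn
  have ha1' : ((XX n N).card : ℝ) ≤ ((allValid n N).card : ℝ) := by exact_mod_cast ha1
  have ha2' : ((allValid n N).card : ℝ) ≤ ((XX n N).card : ℝ) + C * (N : ℝ) ^ (n - 2) := by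
    rw [hCdef]; exact_mod_cast ha2
  rw [hX] at ha1' ha2'
  have hpow : (N : ℝ) ^ n = (N : ℝ) ^ (n - 1) * N := by
    rw [← pow_succ]; congr 1; omega
  have hD2 : (N.descFactorial (n - 1) : ℝ) * N ≤ (N : ℝ) ^ n := by
    rw [hpow]
    apply mul_le_mul_of_nonneg_right _ (Nat.cast_nonneg N)
    exact_mod_cast Nat.descFactorial_le_pow N (n - 1)
  have hD1 : ((N : ℝ) - n) ^ n ≤ (N.descFactorial (n - 1) : ℝ) * N := by
    have h1 : (((N - n : ℕ) : ℝ)) = (N : ℝ) - n := Nat.cast_sub (by omega)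
    rw [← h1]
    have h2 : (N - n) ^ (n - 1) ≤ N.descFactorial (n - 1) :=
      le_trans (Nat.pow_le_pow_left (by omega) _) (Nat.pow_sub_le_descFactorial N (n - 1))
    have h3 : (N - n) ^ n ≤ N.descFactorial (n - 1) * N := by
      calc (N - n) ^ n = (N - n) ^ (n - 1) * (N - n) := by
            rw [← pow_succ]; congr 1; omega
        _ ≤ _ := Nat.mul_le_mul h2 (Nat.sub_le _ _)
    exact_mod_cast h3
  have hmain := asym_real n hn N K (N.descFactorial (n - 1) : ℝ) ((allValid n N).card : ℝ) C
    (by linarith) (by linarith) hK (by positivity) hD1 hD2 ha1' ha2'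
  rw [integral_chebTrace (by omega)]
  have hN0 : (N : ℂ) ≠ 0 := by
    have : N ≠ 0 := by omega
    exact_mod_cast this
  have e : (((allValid n N).card : ℂ) - (N : ℂ) * (N - 3)) * (2 * ((N : ℂ) - 2) ^ n)⁻¹
        - (n : ℂ) / (12 * (N : ℂ)) * (((n : ℂ) + 1) * ((n : ℂ) - 1) - 18)
      = (((((allValid n N).card : ℝ) - (N : ℝ) * (N - 3)) * (2 * ((N : ℝ) - 2) ^ n)⁻¹
        - K / (2 * N) : ℝ) : ℂ) := by
    rw [hKdef]
    push_cast
    congr 1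
    field_simp
    ring
  rw [e, Complex.norm_real, Real.norm_eq_abs]
  exact hmain
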